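/- Let φ be a smooth global degree-zero 1-equivariant wave map (φ(t,0⁺) = φ(t,∞) = 0) of finite energy, and let φ_L be a finite-energy solution of the linear equation φ_tt − φ_rr − (1/r)φ_r + φ/r² = 0 such that ‖φ⃗(t) − φ⃗_L(t)‖_{H×L²} → 0 as t → ∞. Then: (i) limsup_{t→∞} ‖φ⃗(t)‖_{H×L²(|r−t| ≥ A)} → 0 as A → ∞; and (ii) lim_{t→∞} E_{t−A}^{∞}(φ⃗(t)) → E(φ⃗) as A → ∞. -/

import Mathlib

open MeasureTheory Real Filter Set

noncomputable section

/-- The ground state harmonic map `Q(r) = 2 arctan r`. -/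
def Q (r : ℝ) : ℝ := 2 * Real.arctan r

/-- Time derivative `∂ₜψ(t,r)`. -/
def pT (ψ : ℝ → ℝ → ℝ) (t r : ℝ) : ℝ := deriv (fun s => ψ s r) t

/-- Radial derivative `∂ᵣψ(t,r)`. -/
def pR (ψ : ℝ → ℝ → ℝ) (t r : ℝ) : ℝ := deriv (fun ρ => ψ t ρ) r

/-- Energy density `((∂ₜψ)² + (∂ᵣψ)² + sin²ψ/r²) · r`. -/
def eDen (ψ : ℝ → ℝ → ℝ) (t r : ℝ) : ℝ :=
  ((pT ψ t r) ^ 2 + (pR ψ t r) ^ 2 + (Real.sin (ψ t r)) ^ 2 / r ^ 2) * r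

/-- Localized energy `E_{r₁}^{r₂}(ψ⃗(t))`. -/
def locE (ψ : ℝ → ℝ → ℝ) (t r₁ r₂ : ℝ) : ℝ := ∫ r in Set.Ioc r₁ r₂, eDen ψ t r

/-- Total energy `E(ψ⃗(t))`. -/
def totE (ψ : ℝ → ℝ → ℝ) (t : ℝ) : ℝ := ∫ r in Set.Ioi (0:ℝ), eDen ψ t r

/-- `ψ` is a smooth global 1-equivariant wave map on `[0,∞) × (0,∞)`. -/
def IsWaveMap (ψ : ℝ → ℝ → ℝ) : Prop :=
  ContDiffOn ℝ (⊤ : ℕ∞) (fun p : ℝ × ℝ => ψ p.1 p.2) (Set.Ici (0:ℝ) ×ˢ Set.Ioi (0:ℝ)) ∧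
  ∀ t r : ℝ, 0 ≤ t → 0 < r →
    deriv (fun s => pT ψ s r) t - deriv (fun ρ => pR ψ t ρ) r
      - (1 / r) * pR ψ t r + Real.sin (2 * ψ t r) / (2 * r ^ 2) = 0

/-- Finite energy: the energy density is integrable at each time `t ≥ 0`. -/
def FiniteEnergy (ψ : ℝ → ℝ → ℝ) : Prop :=
  ∀ t : ℝ, 0 ≤ t → MeasureTheory.IntegrableOn (eDen ψ t) (Set.Ioi 0) volume

/-- The energy is conserved. -/
def EnergyConserved (ψ : ℝ → ℝ → ℝ) : Prop :=
  ∀ t : ℝ, 0 ≤ t → totE ψ t = totE ψ 0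

/-- Squared `H × L²` norm density `(ψ₁² + (∂ᵣψ₀)² + ψ₀²/r²) · r`. -/
def hl2Den (f g : ℝ → ℝ) (r : ℝ) : ℝ :=
  ((g r) ^ 2 + (deriv f r) ^ 2 + (f r) ^ 2 / r ^ 2) * r

/-- Squared `H × L²` norm of the pair `(f, g)` over the set of radii `S`. -/
def hl2Sq (f g : ℝ → ℝ) (S : Set ℝ) : ℝ := ∫ r in S, hl2Den f g r

/-- Squared `H` norm of `f` over the set of radii `S`. -/
def hSq (f : ℝ → ℝ) (S : Set ℝ) : ℝ :=
  ∫ r in S, ((deriv f r) ^ 2 + (f r) ^ 2 / r ^ 2) * r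

/-- Squared (radial) `L²` norm. -/
def l2Sq (g : ℝ → ℝ) : ℝ := ∫ r in Set.Ioi (0:ℝ), (g r) ^ 2 * r

/-- Wave map energy of a pair of data `(f, g)`. -/
def pairE (f g : ℝ → ℝ) : ℝ :=
  ∫ r in Set.Ioi (0:ℝ), ((g r) ^ 2 + (deriv f r) ^ 2 + (Real.sin (f r)) ^ 2 / r ^ 2) * r

/-- `φ` is a smooth solution of the linearized equation
`φ_tt − φ_rr − (1/r) φ_r + φ/r² = 0` on `ℝ × (0,∞)`. -/
def IsLinearWave (φ : ℝ → ℝ → ℝ) : Prop :=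
  ContDiffOn ℝ (⊤ : ℕ∞) (fun p : ℝ × ℝ => φ p.1 p.2) (Set.univ ×ˢ Set.Ioi (0:ℝ)) ∧
  ∀ t r : ℝ, 0 < r →
    deriv (fun s => pT φ s r) t - deriv (fun ρ => pR φ t ρ) r
      - (1 / r) * pR φ t r + φ t r / r ^ 2 = 0

/-- A linear wave has finite energy: its `H × L²` density is integrable at each time. -/
def LinFiniteEnergy (φ : ℝ → ℝ → ℝ) : Prop :=
  ∀ t : ℝ, MeasureTheory.IntegrableOn (hl2Den (φ t) (pT φ t)) (Set.Ioi 0) volume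

/-- Degree one boundary conditions: `ψ(t,0⁺) = 0`, `ψ(t,∞) = π`. -/
def DegreeOneBC (ψ : ℝ → ℝ → ℝ) : Prop :=
  ∀ t : ℝ, 0 ≤ t →
    Filter.Tendsto (ψ t) (nhdsWithin 0 (Set.Ioi 0)) (nhds 0) ∧
    Filter.Tendsto (ψ t) Filter.atTop (nhds Real.pi)

/-- Degree zero boundary conditions: `φ(t,0⁺) = 0`, `φ(t,∞) = 0`. -/
def DegreeZeroBC (φ : ℝ → ℝ → ℝ) : Prop :=
  ∀ t : ℝ, 0 ≤ t →
    Filter.Tendsto (φ t) (nhdsWithin 0 (Set.Ioi 0)) (nhds 0) ∧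
    Filter.Tendsto (φ t) Filter.atTop (nhds 0)

/-- A cutoff supported in `(a, b) ⊆ (0, ∞)`, with derivative `χ'` of logarithmic size `ε`. -/
structure IsLogCutoff (ε a b : ℝ) (χ χ' : ℝ → ℝ) : Prop where
  pos : 0 < a
  lt : a < b
  nonneg : ∀ r, 0 ≤ χ r
  le_one : ∀ r, χ r ≤ 1
  hasDerivAt : ∀ r, 0 < r → HasDerivAt χ (χ' r) r
  continuousOn : ContinuousOn χ' (Ioi 0)
  abs_le : ∀ r, 0 < r → |r * χ' r| ≤ ε
  eq_zero : ∀ r, 0 < r → r ∉ Ioo a b → χ r = 0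
  deriv_eq_zero : ∀ r, 0 < r → r ∉ Ioo a b → χ' r = 0

theorem exists_logCutoff :
    ∃ (χ χ' : ℕ → ℝ → ℝ) (a b : ℕ → ℝ),
      (∀ n : ℕ, IsLogCutoff (1 / ((n : ℝ) + 1)) (a n) (b n) (χ n) (χ' n)) ∧
      ∀ r, 0 < r → Tendsto (fun n => χ n r) atTop (nhds 1) := by
  let θ : ContDiffBump (0 : ℝ) := ⟨1, 2, one_pos, one_lt_two⟩
  have hθ : ContDiff ℝ 1 (θ : ℝ → ℝ) := θ.contDiff
  have hcd : Continuous (deriv (θ : ℝ → ℝ)) := hθ.continuous_deriv le_rfl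
  have hcs : HasCompactSupport (deriv (θ : ℝ → ℝ)) := θ.hasCompactSupport.deriv
  obtain ⟨C, hC⟩ := hcd.bounded_above_of_compact_support hcs
  have hCpos : 0 < |C| + 1 := by positivity
  let c : ℕ → ℝ := fun n => (|C| + 1) * (n + 1)
  have hc : ∀ n, 0 < c n := fun n => by positivity
  have hzero : ∀ n r, 0 < r → r ∉ Ioo (exp (-(2 * c n))) (exp (2 * c n)) →
      2 ≤ |log r / c n| := by
    intro n r hr hmem
    rw [abs_div, abs_of_pos (hc n), le_div_iff₀ (hc n)]
    by_contra! h
    apply hmem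
    rw [abs_lt] at h
    exact ⟨(lt_log_iff_exp_lt hr).1 h.1, (log_lt_iff_lt_exp hr).1 h.2⟩
  refine ⟨fun n r => θ (log r / c n), fun n r => deriv θ (log r / c n) * (r⁻¹ / c n),
    fun n => exp (-(2 * c n)), fun n => exp (2 * c n), fun n => ?_, fun r hr => ?_⟩
  · refine ⟨exp_pos _, exp_lt_exp.2 (by have := hc n; linarith), fun r => θ.nonneg,
      fun r => θ.le_one, fun r hr => ?_, ?_, fun r hr => ?_, fun r hr hm => ?_, fun r hr hm => ?_⟩
    · exact HasDerivAt.comp (h₂ := (θ : ℝ → ℝ)) (h := fun r => log r / c n) r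
        ((hθ.differentiable one_ne_zero) _).hasDerivAt
        ((hasDerivAt_log hr.ne').div_const _)
    · intro r hr
      have hr' : r ≠ 0 := ne_of_gt hr
      refine ContinuousAt.continuousWithinAt ?_
      refine ContinuousAt.mul (ContinuousAt.comp (f := fun r => log r / c n)
        hcd.continuousAt ((continuousAt_log hr').div_const _))
        ((continuousAt_inv₀ hr').div_const _)
    · have h1 : r * (deriv θ (log r / c n) * (r⁻¹ / c n)) = deriv θ (log r / c n) / c n := by
        field_simp
      rw [h1, abs_div, abs_of_pos (hc n), div_le_div_iff₀ (hc n) (by positivity)]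
      have h2 := hC (log r / c n)
      rw [Real.norm_eq_abs] at h2
      have h3 : |deriv θ (log r / c n)| ≤ |C| + 1 := by linarith [le_abs_self C]
      have : (0 : ℝ) < n + 1 := by positivity
      simp only [c]
      nlinarith
    · have := hzero n r hr hm
      apply θ.zero_of_le_dist
      simpa only [Real.dist_eq, sub_zero] using this
    · have h2 := hzero n r hr hm
      have : deriv θ (log r / c n) = 0 := by
        have hev : (∀ᶠ x in nhds (log r / c n), 0 ≤ θ x) := Eventually.of_forall fun x => θ.nonneg
        have h0 : θ (log r / c n) = 0 := θ.zero_of_le_dist (by simpa only [Real.dist_eq, sub_zero] using h2)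
        refine IsLocalMin.deriv_eq_zero ?_
        filter_upwards [hev] with x hx
        rw [h0]; exact hx
      simp [this]
  · apply tendsto_const_nhds.congr'
    obtain ⟨N, hN⟩ := exists_nat_gt |log r|
    filter_upwards [eventually_ge_atTop N] with n hn
    symm
    apply θ.one_of_mem_closedBall
    rw [mem_closedBall_zero_iff, Real.norm_eq_abs, abs_div, abs_of_pos (hc n)]
    show _ ≤ (1 : ℝ)
    rw [div_le_one (hc n)]
    have : (N : ℝ) ≤ n := by exact_mod_cast hn
    simp only [c]
    nlinarith [abs_nonneg C]

namespace IsLogCutoff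

variable {ε a b : ℝ} {χ χ' : ℝ → ℝ}

theorem setIntegral_eq (h : IsLogCutoff ε a b χ χ') {F : ℝ → ℝ}
    (hF : ∀ r, 0 < r → r ∉ Ioo a b → F r = 0) :
    ∫ r in Ioi 0, F r = ∫ r in a..b, F r := by
  rw [intervalIntegral.integral_of_le h.lt.le]
  apply setIntegral_eq_of_subset_of_forall_sdiff_eq_zero measurableSet_Ioi
  · intro r hr; exact lt_trans h.pos hr.1
  · intro r hr
    exact hF r hr.1 fun hm => hr.2 ⟨hm.1, hm.2.le⟩

theorem integrableOn_of (h : IsLogCutoff ε a b χ χ') {F : ℝ → ℝ} (hc : ContinuousOn F (Ioi 0))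
    (hF : ∀ r, 0 < r → r ∉ Ioo a b → F r = 0) : IntegrableOn F (Ioi 0) := by
  have h1 : IntegrableOn F (Icc a b) :=
    (hc.mono fun r hr => lt_of_lt_of_le h.pos hr.1).integrableOn_Icc
  refine h1.of_forall_sdiff_eq_zero measurableSet_Ioi ?_
  intro r hr
  exact hF r hr.1 fun hm => hr.2 ⟨hm.1.le, hm.2.le⟩

theorem continuousOn_self (h : IsLogCutoff ε a b χ χ') : ContinuousOn χ (Ioi 0) :=
  fun r hr => (h.hasDerivAt r hr).continuousAt.continuousWithinAt

theorem integrableOn_mul (h : IsLogCutoff ε a b χ χ') {F : ℝ → ℝ} (hc : ContinuousOn F (Ioi 0)) :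
    IntegrableOn (fun r => χ r * F r) (Ioi 0) :=
  h.integrableOn_of (h.continuousOn_self.mul hc) fun r hr hm => by rw [h.eq_zero r hr hm, zero_mul]

theorem integral_mul_deriv (h : IsLogCutoff ε a b χ χ') {P P' : ℝ → ℝ}
    (hP : ∀ r, 0 < r → HasDerivAt P (P' r) r) (hP' : ContinuousOn P' (Ioi 0)) :
    ∫ r in Ioi 0, χ r * P' r = - ∫ r in Ioi 0, χ' r * P r := by
  rw [h.setIntegral_eq fun r hr hm => by rw [h.eq_zero r hr hm, zero_mul],
    h.setIntegral_eq fun r hr hm => by rw [h.deriv_eq_zero r hr hm, zero_mul]]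
  have hsub : uIcc a b ⊆ Ioi 0 := by
    rw [uIcc_of_le h.lt.le]; exact fun r hr => lt_of_lt_of_le h.pos hr.1
  rw [intervalIntegral.integral_mul_deriv_eq_deriv_mul (fun r hr => h.hasDerivAt r (hsub hr))
    (fun r hr => hP r (hsub hr)) (h.continuousOn.mono hsub).intervalIntegrable
    (hP'.mono hsub).intervalIntegrable]
  rw [h.eq_zero a h.pos (by simp), h.eq_zero b (h.pos.trans h.lt) (by simp)]
  ring

theorem abs_integral_mul_deriv_le (h : IsLogCutoff ε a b χ χ') {P P' ρ : ℝ → ℝ}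
    (hP : ∀ r, 0 < r → HasDerivAt P (P' r) r) (hP' : ContinuousOn P' (Ioi 0))
    (hρ : IntegrableOn ρ (Ioi 0)) (hle : ∀ r, 0 < r → |P r| ≤ r * ρ r) :
    |∫ r in Ioi 0, χ r * P' r| ≤ ε * ∫ r in Ioi 0, ρ r := by
  rw [h.integral_mul_deriv hP hP', abs_neg, ← Real.norm_eq_abs, ← integral_const_mul]
  refine norm_integral_le_of_norm_le (hρ.const_mul ε) ?_
  refine (ae_restrict_iff' measurableSet_Ioi).2 (Eventually.of_forall fun r hr => ?_)
  have hr : 0 < r := hr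
  have h1 := h.abs_le r hr
  have h2 := hle r hr
  have hρ0 : 0 ≤ ρ r := by
    have := (abs_nonneg _).trans h2
    exact nonneg_of_mul_nonneg_right this hr
  rw [abs_mul, abs_of_pos hr] at h1
  rw [Real.norm_eq_abs, abs_mul]
  calc |χ' r| * |P r| ≤ |χ' r| * (r * ρ r) := by gcongr
    _ = (r * |χ' r|) * ρ r := by ring
    _ ≤ ε * ρ r := by gcongr

theorem hasDerivAt_integral (h : IsLogCutoff ε a b χ χ') {I : Set ℝ} (hI : IsOpen I)
    {D D' : ℝ → ℝ → ℝ}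
    (hD : ∀ t ∈ I, ∀ r, 0 < r → HasDerivAt (fun s => D s r) (D' t r) t)
    (hDc : ∀ t ∈ I, ContinuousOn (D t) (Ioi 0))
    (hD' : ContinuousOn (fun p : ℝ × ℝ => D' p.1 p.2) (I ×ˢ Ioi 0)) {t : ℝ} (ht : t ∈ I) :
    HasDerivAt (fun s => ∫ r in Ioi 0, χ r * D s r) (∫ r in Ioi 0, χ r * D' t r) t := by
  have e1 : ∀ F : ℝ → ℝ, ∫ r in Ioi 0, χ r * F r = ∫ r in a..b, χ r * F r := fun F =>
    h.setIntegral_eq fun r hr hm => by rw [h.eq_zero r hr hm, zero_mul]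
  simp only [e1]
  obtain ⟨δ, hδ, hball⟩ := Metric.nhds_basis_closedBall.mem_iff.1 (hI.mem_nhds ht)
  have hsub : Icc a b ⊆ Ioi 0 := fun r hr => lt_of_lt_of_le h.pos hr.1
  have hsubI : Set.uIoc a b ⊆ Ioi 0 := by
    rw [uIoc_of_le h.lt.le]; exact fun r hr => lt_trans h.pos hr.1
  have hcomp : IsCompact (Metric.closedBall t δ ×ˢ Icc a b) :=
    (isCompact_closedBall t δ).prod isCompact_Icc
  obtain ⟨C, hC⟩ := hcomp.exists_bound_of_continuousOn
    (hD'.mono (Set.prod_mono hball hsub))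
  have hint : ∀ s ∈ I, IntervalIntegrable (fun r => χ r * D s r) volume a b := fun s hs =>
    ContinuousOn.intervalIntegrable (by
      rw [uIcc_of_le h.lt.le]; exact (h.continuousOn_self.mul (hDc s hs)).mono hsub)
  have hD't : ContinuousOn (D' t) (Ioi 0) :=
    hD'.comp (f := fun r => (t, r)) (by fun_prop) fun r hr => ⟨ht, hr⟩
  refine (intervalIntegral.hasDerivAt_integral_of_dominated_loc_of_deriv_le
    (F := fun s r => χ r * D s r) (F' := fun s r => χ r * D' s r) (bound := fun _ => C)
    (Metric.closedBall_mem_nhds t hδ) ?_ (hint t ht) ?_ ?_ ?_ ?_).2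
  · filter_upwards [hI.mem_nhds ht] with s hs
    exact (hint s hs).aestronglyMeasurable_restrict_uIoc
  · refine ContinuousOn.aestronglyMeasurable ?_ measurableSet_uIoc
    exact (h.continuousOn_self.mul hD't).mono hsubI
  · refine Eventually.of_forall fun r hr s hs => ?_
    rw [uIoc_of_le h.lt.le] at hr
    rw [norm_mul, Real.norm_of_nonneg (h.nonneg r)]
    have := hC (s, r) ⟨hs, hr.1.le, hr.2⟩
    exact (mul_le_of_le_one_left (norm_nonneg _) (h.le_one r)).trans this
  · exact intervalIntegrable_const
  · refine Eventually.of_forall fun r hr s hs => ?_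
    exact (hD s (hball hs) r (hsubI hr)).const_mul _

end IsLogCutoff

theorem tendsto_integral_cutoff {χ χ' : ℕ → ℝ → ℝ} {ε a b : ℕ → ℝ}
    (hχ : ∀ n : ℕ, IsLogCutoff (ε n) (a n) (b n) (χ n) (χ' n))
    (hlim : ∀ r, 0 < r → Tendsto (fun n => χ n r) atTop (nhds 1)) {F : ℝ → ℝ}
    (hF : IntegrableOn F (Ioi 0)) :
    Tendsto (fun n => ∫ r in Ioi 0, χ n r * F r) atTop (nhds (∫ r in Ioi 0, F r)) := by
  refine tendsto_integral_of_dominated_convergence (fun r => ‖F r‖) (fun n => ?_) hF.norm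
    (fun n => ?_) ?_
  · exact ((hχ n).continuousOn_self.aestronglyMeasurable measurableSet_Ioi).mul
      hF.aestronglyMeasurable
  · refine Eventually.of_forall fun r => ?_
    rw [norm_mul, Real.norm_of_nonneg ((hχ n).nonneg r)]
    exact mul_le_of_le_one_left (norm_nonneg _) ((hχ n).le_one r)
  · refine (ae_restrict_iff' measurableSet_Ioi).2 (Eventually.of_forall fun r hr => ?_)
    simpa using (hlim r hr).mul_const (F r)

/-- The functions `p, q, pp, pq, qq` are the partial derivatives `uₜ, uᵣ, uₜₜ, uₜᵣ, uᵣᵣ` of `u`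
on `I × (0, ∞)`, and all of them are continuous there. -/
structure IsJet (I : Set ℝ) (u p q pp pq qq : ℝ → ℝ → ℝ) : Prop where
  dt : ∀ t ∈ I, ∀ r, 0 < r → HasDerivAt (fun s => u s r) (p t r) t
  dr : ∀ t ∈ I, ∀ r, 0 < r → HasDerivAt (u t) (q t r) r
  dtt : ∀ t ∈ I, ∀ r, 0 < r → HasDerivAt (fun s => p s r) (pp t r) t
  dtr : ∀ t ∈ I, ∀ r, 0 < r → HasDerivAt (p t) (pq t r) r
  drt : ∀ t ∈ I, ∀ r, 0 < r → HasDerivAt (fun s => q s r) (pq t r) t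
  drr : ∀ t ∈ I, ∀ r, 0 < r → HasDerivAt (q t) (qq t r) r
  cu : ContinuousOn (fun x : ℝ × ℝ => u x.1 x.2) (I ×ˢ Ioi 0)
  cp : ContinuousOn (fun x : ℝ × ℝ => p x.1 x.2) (I ×ˢ Ioi 0)
  cq : ContinuousOn (fun x : ℝ × ℝ => q x.1 x.2) (I ×ˢ Ioi 0)
  cpp : ContinuousOn (fun x : ℝ × ℝ => pp x.1 x.2) (I ×ˢ Ioi 0)
  cpq : ContinuousOn (fun x : ℝ × ℝ => pq x.1 x.2) (I ×ˢ Ioi 0)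
  cqq : ContinuousOn (fun x : ℝ × ℝ => qq x.1 x.2) (I ×ˢ Ioi 0)

theorem continuousOn_slice {I : Set ℝ} {F : ℝ → ℝ → ℝ}
    (h : ContinuousOn (fun x : ℝ × ℝ => F x.1 x.2) (I ×ˢ Ioi 0)) {t : ℝ} (ht : t ∈ I) :
    ContinuousOn (F t) (Ioi 0) :=
  h.comp (f := fun r => (t, r)) (by fun_prop) fun _ hr => ⟨ht, hr⟩

section Smooth

variable {U : Set (ℝ × ℝ)} {ψ : ℝ → ℝ → ℝ}

theorem hasDerivAt_pT_of_differentiableAt {t r : ℝ}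
    (h : DifferentiableAt ℝ (fun x : ℝ × ℝ => ψ x.1 x.2) (t, r)) :
    HasDerivAt (fun s => ψ s r) (fderiv ℝ (fun x : ℝ × ℝ => ψ x.1 x.2) (t, r) (1, 0)) t := by
  have h1 : HasDerivAt (fun s : ℝ => (s, r)) ((1 : ℝ), (0 : ℝ)) t :=
    (hasDerivAt_id t).prodMk (hasDerivAt_const t r)
  exact h.hasFDerivAt.comp_hasDerivAt (f := fun s : ℝ => (s, r)) t h1

theorem hasDerivAt_pR_of_differentiableAt {t r : ℝ}
    (h : DifferentiableAt ℝ (fun x : ℝ × ℝ => ψ x.1 x.2) (t, r)) :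
    HasDerivAt (ψ t) (fderiv ℝ (fun x : ℝ × ℝ => ψ x.1 x.2) (t, r) (0, 1)) r := by
  have h1 : HasDerivAt (fun s : ℝ => (t, s)) ((0 : ℝ), (1 : ℝ)) r :=
    (hasDerivAt_const r t).prodMk (hasDerivAt_id r)
  exact h.hasFDerivAt.comp_hasDerivAt (f := fun s : ℝ => (t, s)) r h1

theorem differentiableAt_of_smooth (hU : IsOpen U)
    (h : ContDiffOn ℝ (⊤ : ℕ∞) (fun x : ℝ × ℝ => ψ x.1 x.2) U) {x : ℝ × ℝ} (hx : x ∈ U) :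
    DifferentiableAt ℝ (fun x : ℝ × ℝ => ψ x.1 x.2) x :=
  (h.contDiffAt (hU.mem_nhds hx)).differentiableAt (by simp)

theorem pT_eq_fderiv (hU : IsOpen U)
    (h : ContDiffOn ℝ (⊤ : ℕ∞) (fun x : ℝ × ℝ => ψ x.1 x.2) U) {x : ℝ × ℝ} (hx : x ∈ U) :
    pT ψ x.1 x.2 = fderiv ℝ (fun x : ℝ × ℝ => ψ x.1 x.2) x (1, 0) :=
  (hasDerivAt_pT_of_differentiableAt (differentiableAt_of_smooth hU h hx)).deriv

theorem pR_eq_fderiv (hU : IsOpen U)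
    (h : ContDiffOn ℝ (⊤ : ℕ∞) (fun x : ℝ × ℝ => ψ x.1 x.2) U) {x : ℝ × ℝ} (hx : x ∈ U) :
    pR ψ x.1 x.2 = fderiv ℝ (fun x : ℝ × ℝ => ψ x.1 x.2) x (0, 1) :=
  (hasDerivAt_pR_of_differentiableAt (differentiableAt_of_smooth hU h hx)).deriv

theorem hasDerivAt_pT (hU : IsOpen U)
    (h : ContDiffOn ℝ (⊤ : ℕ∞) (fun x : ℝ × ℝ => ψ x.1 x.2) U) {t r : ℝ} (hx : (t, r) ∈ U) :
    HasDerivAt (fun s => ψ s r) (pT ψ t r) t :=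
  (hasDerivAt_pT_of_differentiableAt
    (differentiableAt_of_smooth hU h hx)).differentiableAt.hasDerivAt

theorem hasDerivAt_pR (hU : IsOpen U)
    (h : ContDiffOn ℝ (⊤ : ℕ∞) (fun x : ℝ × ℝ => ψ x.1 x.2) U) {t r : ℝ} (hx : (t, r) ∈ U) :
    HasDerivAt (ψ t) (pR ψ t r) r :=
  (hasDerivAt_pR_of_differentiableAt
    (differentiableAt_of_smooth hU h hx)).differentiableAt.hasDerivAt

theorem contDiffOn_fderiv_apply (hU : IsOpen U) {F : ℝ × ℝ → ℝ}
    (h : ContDiffOn ℝ (⊤ : ℕ∞) F U) (v : ℝ × ℝ) :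
    ContDiffOn ℝ (⊤ : ℕ∞) (fun x => fderiv ℝ F x v) U :=
  (h.fderiv_of_isOpen hU (by simp)).clm_apply contDiffOn_const

theorem contDiffOn_pT (hU : IsOpen U)
    (h : ContDiffOn ℝ (⊤ : ℕ∞) (fun x : ℝ × ℝ => ψ x.1 x.2) U) :
    ContDiffOn ℝ (⊤ : ℕ∞) (fun x : ℝ × ℝ => pT ψ x.1 x.2) U :=
  (contDiffOn_fderiv_apply hU h (1, 0)).congr fun _ hx => pT_eq_fderiv hU h hx

theorem contDiffOn_pR (hU : IsOpen U)
    (h : ContDiffOn ℝ (⊤ : ℕ∞) (fun x : ℝ × ℝ => ψ x.1 x.2) U) :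
    ContDiffOn ℝ (⊤ : ℕ∞) (fun x : ℝ × ℝ => pR ψ x.1 x.2) U :=
  (contDiffOn_fderiv_apply hU h (0, 1)).congr fun _ hx => pR_eq_fderiv hU h hx

theorem pT_pR_comm (hU : IsOpen U)
    (h : ContDiffOn ℝ (⊤ : ℕ∞) (fun x : ℝ × ℝ => ψ x.1 x.2) U) {x : ℝ × ℝ} (hx : x ∈ U) :
    pT (pR ψ) x.1 x.2 = pR (pT ψ) x.1 x.2 := by
  set F := fun x : ℝ × ℝ => ψ x.1 x.2 with hF
  have hF2 : DifferentiableAt ℝ (fderiv ℝ F) x :=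
    ((h.fderiv_of_isOpen (m := (⊤ : ℕ∞)) hU (by simp)).contDiffAt
      (hU.mem_nhds hx)).differentiableAt (by simp)
  have e1 : ∀ v, fderiv ℝ (fun y => fderiv ℝ F y v) x = (fderiv ℝ (fderiv ℝ F) x).flip v := by
    intro v
    rw [fderiv_clm_apply hF2 (differentiableAt_const v)]
    ext <;> simp
  have eT : (fun x : ℝ × ℝ => pT ψ x.1 x.2) =ᶠ[nhds x] fun y => fderiv ℝ F y (1, 0) := by
    filter_upwards [hU.mem_nhds hx] with y hy using pT_eq_fderiv hU h hy
  have eR : (fun x : ℝ × ℝ => pR ψ x.1 x.2) =ᶠ[nhds x] fun y => fderiv ℝ F y (0, 1) := by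
    filter_upwards [hU.mem_nhds hx] with y hy using pR_eq_fderiv hU h hy
  rw [pT_eq_fderiv hU (contDiffOn_pR hU h) hx, pR_eq_fderiv hU (contDiffOn_pT hU h) hx,
    eT.fderiv_eq, eR.fderiv_eq, e1, e1]
  have hs : IsSymmSndFDerivAt ℝ F x :=
    (h.contDiffAt (hU.mem_nhds hx)).isSymmSndFDerivAt (by
      rw [minSmoothness_of_isRCLikeNormedField]
      exact WithTop.coe_le_coe.2 (le_top : (2 : ℕ∞) ≤ ⊤))
  exact hs.eq (1, 0) (0, 1)

end Smooth

theorem isJet_of_smooth {I : Set ℝ} (hI : IsOpen I) {ψ : ℝ → ℝ → ℝ}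
    (h : ContDiffOn ℝ (⊤ : ℕ∞) (fun x : ℝ × ℝ => ψ x.1 x.2) (I ×ˢ Ioi 0)) :
    IsJet I ψ (pT ψ) (pR ψ) (pT (pT ψ)) (pR (pT ψ)) (pR (pR ψ)) := by
  have hU : IsOpen (I ×ˢ Ioi (0 : ℝ)) := hI.prod isOpen_Ioi
  have hT := contDiffOn_pT hU h
  have hR := contDiffOn_pR hU h
  refine ⟨fun t ht r hr => hasDerivAt_pT hU h ⟨ht, hr⟩, fun t ht r hr => hasDerivAt_pR hU h ⟨ht, hr⟩,
    fun t ht r hr => hasDerivAt_pT hU hT ⟨ht, hr⟩, fun t ht r hr => hasDerivAt_pR hU hT ⟨ht, hr⟩,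
    fun t ht r hr => ?_, fun t ht r hr => hasDerivAt_pR hU hR ⟨ht, hr⟩, h.continuousOn,
    hT.continuousOn, hR.continuousOn, (contDiffOn_pT hU hT).continuousOn,
    (contDiffOn_pR hU hT).continuousOn, (contDiffOn_pR hU hR).continuousOn⟩
  rw [← pT_pR_comm hU h (x := (t, r)) ⟨ht, hr⟩]
  exact hasDerivAt_pT hU hR ⟨ht, hr⟩

theorem IsJet.shift {u p q pp pq qq : ℝ → ℝ → ℝ} (h : IsJet univ u p q pp pq qq) (c : ℝ) :
    IsJet univ (fun t => u (c + t)) (fun t => p (c + t)) (fun t => q (c + t))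
      (fun t => pp (c + t)) (fun t => pq (c + t)) (fun t => qq (c + t)) := by
  have key : ∀ {F : ℝ → ℝ → ℝ}, ContinuousOn (fun x : ℝ × ℝ => F x.1 x.2) (univ ×ˢ Ioi 0) →
      ContinuousOn (fun x : ℝ × ℝ => F (c + x.1) x.2) (univ ×ˢ Ioi 0) := fun hF =>
    hF.comp (f := fun x : ℝ × ℝ => (c + x.1, x.2)) (by fun_prop) fun x hx => ⟨mem_univ _, hx.2⟩
  exact ⟨fun t _ r hr => (h.dt (c + t) (mem_univ _) r hr).comp_const_add c t,
    fun t _ r hr => h.dr (c + t) (mem_univ _) r hr,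
    fun t _ r hr => (h.dtt (c + t) (mem_univ _) r hr).comp_const_add c t,
    fun t _ r hr => h.dtr (c + t) (mem_univ _) r hr,
    fun t _ r hr => (h.drt (c + t) (mem_univ _) r hr).comp_const_add c t,
    fun t _ r hr => h.drr (c + t) (mem_univ _) r hr,
    key h.cu, key h.cp, key h.cq, key h.cpp, key h.cpq, key h.cqq⟩

/-- Linear energy density of the data `(u, p)` with radial derivative `q`. -/
def linDen (u p q : ℝ → ℝ → ℝ) (t r : ℝ) : ℝ :=
  ((p t r) ^ 2 + (q t r) ^ 2 + (u t r) ^ 2 / r ^ 2) * r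

/-- A solution of the linear equation on `ℝ × (0, ∞)`, presented by its jet, whose energy is finite
at every time. -/
structure IsLinSol (u p q pp pq qq : ℝ → ℝ → ℝ) : Prop where
  jet : IsJet univ u p q pp pq qq
  eqn : ∀ t r, 0 < r → pp t r = qq t r + q t r / r - u t r / r ^ 2
  fin : ∀ t, IntegrableOn (linDen u p q t) (Ioi 0)

theorem linDen_nonneg (u p q : ℝ → ℝ → ℝ) (t : ℝ) {r : ℝ} (hr : 0 < r) :
    0 ≤ linDen u p q t r := by
  unfold linDen; positivity

theorem setIntegral_linDen_nonneg (u p q : ℝ → ℝ → ℝ) (t : ℝ) :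
    0 ≤ ∫ r in Ioi 0, linDen u p q t r :=
  setIntegral_nonneg measurableSet_Ioi fun _ hr => linDen_nonneg u p q t hr

/-- Polarization of the linear energy density. -/
def linBil (u p q : ℝ → ℝ → ℝ) (t s r : ℝ) : ℝ :=
  (p t r * p s r + q t r * q s r + u t r * u s r / r ^ 2) * r

theorem linBil_self (u p q : ℝ → ℝ → ℝ) (t r : ℝ) : linBil u p q t t r = linDen u p q t r := by
  unfold linBil linDen; ring

theorem abs_linBil_le (u p q : ℝ → ℝ → ℝ) (t s : ℝ) {η r : ℝ} (hη : 0 < η) (hr : 0 < r) :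
    |linBil u p q t s r| ≤ η * linDen u p q t r + η⁻¹ * linDen u p q s r := by
  have key : ∀ x y : ℝ, |x * y| ≤ η * x ^ 2 + η⁻¹ * y ^ 2 := by
    intro x y
    have h0 : 0 ≤ η * x ^ 2 + η⁻¹ * y ^ 2 := by positivity
    have h1 : (η * x ^ 2) * (η⁻¹ * y ^ 2) = (x * y) ^ 2 := by field_simp
    apply abs_le_of_sq_le_sq _ h0
    nlinarith [mul_nonneg (by positivity : 0 ≤ η * x ^ 2) (by positivity : 0 ≤ η⁻¹ * y ^ 2),
      sq_nonneg (η * x ^ 2), sq_nonneg (η⁻¹ * y ^ 2)]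
  have h1 := key (p t r) (p s r)
  have h2 := key (q t r) (q s r)
  have h3 := key (u t r / r) (u s r / r)
  have e : linBil u p q t s r =
      (p t r * p s r + q t r * q s r + (u t r / r) * (u s r / r)) * r := by
    unfold linBil; field_simp
  rw [e, abs_mul, abs_of_pos hr]
  have h4 := (abs_add_three (p t r * p s r) (q t r * q s r) ((u t r / r) * (u s r / r)))
  calc _ ≤ (η * (p t r) ^ 2 + η⁻¹ * (p s r) ^ 2 + (η * (q t r) ^ 2 + η⁻¹ * (q s r) ^ 2)
        + (η * (u t r / r) ^ 2 + η⁻¹ * (u s r / r) ^ 2)) * r := by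
        gcongr; linarith
    _ = _ := by unfold linDen; ring

theorem abs_mul_le_linDen (u p q : ℝ → ℝ → ℝ) (t s : ℝ) {r : ℝ} (hr : 0 < r) :
    |r * (q t r * u s r)| ≤ r * (linDen u p q t r + linDen u p q s r) := by
  rw [abs_mul, abs_of_pos hr]
  gcongr
  have e : q t r * u s r = (q t r * (u s r / r)) * r := by field_simp
  rw [e, abs_mul, abs_of_pos hr]
  unfold linDen
  rw [← add_mul]
  gcongr
  have h1 : |q t r * (u s r / r)| ≤ (q t r) ^ 2 + (u s r / r) ^ 2 := by
    rw [abs_le]; constructor <;> nlinarith [sq_nonneg (q t r + u s r / r),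
      sq_nonneg (q t r - u s r / r), sq_nonneg (q t r), sq_nonneg (u s r / r)]
  rw [div_pow] at h1
  have : 0 ≤ (u t r) ^ 2 / r ^ 2 := by positivity
  nlinarith [sq_nonneg (p t r), sq_nonneg (p s r), sq_nonneg (q s r)]

namespace IsLinSol

variable {u p q pp pq qq : ℝ → ℝ → ℝ}

theorem continuousOn_linDen (h : IsLinSol u p q pp pq qq) (t : ℝ) :
    ContinuousOn (linDen u p q t) (Ioi 0) := by
  have h1 := continuousOn_slice h.jet.cu (mem_univ t)
  have h2 := continuousOn_slice h.jet.cp (mem_univ t)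
  have h3 := continuousOn_slice h.jet.cq (mem_univ t)
  unfold linDen
  fun_prop (disch := first | exact fun x hx => pow_ne_zero _ (ne_of_gt hx) | fail)

theorem continuousOn_linBil (h : IsLinSol u p q pp pq qq) (t s : ℝ) :
    ContinuousOn (linBil u p q t s) (Ioi 0) := by
  have h1 := continuousOn_slice h.jet.cu (mem_univ t)
  have h2 := continuousOn_slice h.jet.cp (mem_univ t)
  have h3 := continuousOn_slice h.jet.cq (mem_univ t)
  have h4 := continuousOn_slice h.jet.cu (mem_univ s)
  have h5 := continuousOn_slice h.jet.cp (mem_univ s)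
  have h6 := continuousOn_slice h.jet.cq (mem_univ s)
  unfold linBil
  fun_prop (disch := first | exact fun x hx => pow_ne_zero _ (ne_of_gt hx) | fail)

theorem hasDerivAt_linBil (h : IsLinSol u p q pp pq qq) {ε a b : ℝ} {χ χ' : ℝ → ℝ}
    (hχ : IsLogCutoff ε a b χ χ') (t s : ℝ) :
    HasDerivAt (fun s => ∫ r in Ioi 0, χ r * linBil u p q s t r)
      (∫ r in Ioi 0, χ r * ((pp s r * p t r + pq s r * q t r + p s r * u t r / r ^ 2) * r)) s := by
  refine hχ.hasDerivAt_integral (I := univ) isOpen_univ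
    (D := fun s => linBil u p q s t)
    (D' := fun s r => (pp s r * p t r + pq s r * q t r + p s r * u t r / r ^ 2) * r)
    (fun s hs r hr => ?_) (fun s _ => h.continuousOn_linBil s t) ?_ (mem_univ s)
  · have h1 := h.jet.dt s hs r hr
    have h2 := h.jet.dtt s hs r hr
    have h3 := h.jet.drt s hs r hr
    exact ((((h2.mul_const _).add (h3.mul_const _)).add ((h1.mul_const _).div_const _)).mul_const r)
  · have h1 := h.jet.cp
    have h2 := h.jet.cpp
    have h3 := h.jet.cpq
    have key : ∀ {F : ℝ → ℝ → ℝ}, ContinuousOn (fun x : ℝ × ℝ => F x.1 x.2) (univ ×ˢ Ioi 0) →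
      ContinuousOn (fun x : ℝ × ℝ => F t x.2) (univ ×ˢ Ioi 0) := fun hF =>
      hF.comp (f := fun x : ℝ × ℝ => (t, x.2)) (by fun_prop) fun x hx => ⟨mem_univ _, hx.2⟩
    have h4 := key h.jet.cu
    have h5 := key h.jet.cp
    have h6 := key h.jet.cq
    exact (((h2.mul h5).add (h3.mul h6)).add ((h1.mul h4).div (continuousOn_snd.pow 2)
      fun x hx => pow_ne_zero _ (ne_of_gt hx.2))).mul continuousOn_snd

end IsLinSol

namespace IsJet

variable {I : Set ℝ} {u p q pp pq qq : ℝ → ℝ → ℝ} {t : ℝ}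

theorem slice_u (h : IsJet I u p q pp pq qq) (ht : t ∈ I) : ContinuousOn (u t) (Ioi 0) :=
  continuousOn_slice h.cu ht

theorem slice_p (h : IsJet I u p q pp pq qq) (ht : t ∈ I) : ContinuousOn (p t) (Ioi 0) :=
  continuousOn_slice h.cp ht

theorem slice_q (h : IsJet I u p q pp pq qq) (ht : t ∈ I) : ContinuousOn (q t) (Ioi 0) :=
  continuousOn_slice h.cq ht

theorem slice_pp (h : IsJet I u p q pp pq qq) (ht : t ∈ I) : ContinuousOn (pp t) (Ioi 0) :=
  continuousOn_slice h.cpp ht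

theorem slice_pq (h : IsJet I u p q pp pq qq) (ht : t ∈ I) : ContinuousOn (pq t) (Ioi 0) :=
  continuousOn_slice h.cpq ht

theorem slice_qq (h : IsJet I u p q pp pq qq) (ht : t ∈ I) : ContinuousOn (qq t) (Ioi 0) :=
  continuousOn_slice h.cqq ht

end IsJet

namespace IsLinSol

variable {u p q pp pq qq : ℝ → ℝ → ℝ}

/-- The truncated symplectic form of `u (t + s)` and `u t` varies slowly in `t`. -/
theorem exists_hasDerivAt_symplectic_left (h : IsLinSol u p q pp pq qq) {ε a b : ℝ} {χ χ' : ℝ → ℝ}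
    (hχ : IsLogCutoff ε a b χ χ') (s t : ℝ) :
    ∃ w, HasDerivAt (fun t => ∫ r in Ioi 0, χ r * (r * (p (s + t) r * u t r - u (s + t) r * p t r)))
      w t ∧ |w| ≤ ε * (2 * ((∫ r in Ioi 0, linDen u p q (s + t) r) +
        ∫ r in Ioi 0, linDen u p q t r)) := by
  have hs := h.jet.shift s
  have hj := h.jet
  refine ⟨_, hχ.hasDerivAt_integral (I := univ) isOpen_univ
    (D := fun t r => r * (p (s + t) r * u t r - u (s + t) r * p t r))
    (D' := fun t r => r * (pp (s + t) r * u t r - u (s + t) r * pp t r))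
    (fun t ht r hr => ?_) (fun t ht => ?_) ?_ (mem_univ t), ?_⟩
  · have h1 := hs.dt t ht r hr
    have h2 := hs.dtt t ht r hr
    have h3 := hj.dt t ht r hr
    have h4 := hj.dtt t ht r hr
    exact (((h2.mul h3).sub (h1.mul h4)).const_mul r).congr_deriv (by ring)
  · have h1 := hs.slice_u ht
    have h2 := hs.slice_p ht
    have h3 := hj.slice_u ht
    have h4 := hj.slice_p ht
    exact continuousOn_id.mul ((h2.mul h3).sub (h1.mul h4))
  · exact continuousOn_snd.mul ((hs.cpp.mul hj.cu).sub (hs.cu.mul hj.cpp))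
  · have ht := mem_univ t
    have e : ∀ r ∈ Ioi (0 : ℝ), χ r * (r * (pp (s + t) r * u t r - u (s + t) r * pp t r)) =
        χ r * ((1 * (q (s + t) r * u t r - u (s + t) r * q t r) +
          r * (qq (s + t) r * u t r + q (s + t) r * q t r
            - (q (s + t) r * q t r + u (s + t) r * qq t r)))) := by
      intro r hr
      have hr0 : r ≠ 0 := ne_of_gt hr
      rw [h.eqn _ _ hr, h.eqn _ _ hr]
      field_simp
      ring
    rw [setIntegral_congr_fun measurableSet_Ioi e]
    have h1 := hs.slice_u ht
    have h2 := hs.slice_q ht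
    have h3 := hj.slice_u ht
    have h4 := hj.slice_q ht
    have h5 := hs.slice_qq ht
    have h6 := hj.slice_qq ht
    rw [← integral_add (h.fin _) (h.fin _), ← integral_const_mul]
    refine hχ.abs_integral_mul_deriv_le
      (P := fun r => r * (q (s + t) r * u t r - u (s + t) r * q t r)) (fun r hr => ?_) ?_
      (((h.fin _).add (h.fin _)).const_mul 2) (fun r hr => ?_)
    · exact (hasDerivAt_id r).mul (((hs.drr t ht r hr).mul (hj.dr t ht r hr)).sub
        ((hs.dr t ht r hr).mul (hj.drr t ht r hr)))
    · exact (continuousOn_const.mul ((h2.mul h3).sub (h1.mul h4))).add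
        (continuousOn_id.mul (((h5.mul h3).add (h2.mul h4)).sub ((h2.mul h4).add (h1.mul h6))))
    · have k1 := abs_mul_le_linDen u p q (s + t) t hr
      have k2 := abs_mul_le_linDen u p q t (s + t) hr
      have e2 : r * (q (s + t) r * u t r - u (s + t) r * q t r) =
        r * (q (s + t) r * u t r) - r * (q t r * u (s + t) r) := by ring
      rw [e2]
      refine (abs_sub _ _).trans ?_
      linarith

theorem exists_hasDerivAt_symplectic_right (h : IsLinSol u p q pp pq qq) {ε a b : ℝ} {χ χ' : ℝ → ℝ}
    (hχ : IsLogCutoff ε a b χ χ') (t s : ℝ) :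
    ∃ w, HasDerivAt (fun s => ∫ r in Ioi 0, χ r * (r * (p (t + s) r * u t r - u (t + s) r * p t r)))
      w s ∧ |w + ∫ r in Ioi 0, χ r * linBil u p q (t + s) t r| ≤
        ε * ((∫ r in Ioi 0, linDen u p q (t + s) r) + ∫ r in Ioi 0, linDen u p q t r) := by
  have hs := h.jet.shift t
  have hj := h.jet
  have key : ∀ {F : ℝ → ℝ → ℝ}, ContinuousOn (fun x : ℝ × ℝ => F x.1 x.2) (univ ×ˢ Ioi 0) →
      ContinuousOn (fun x : ℝ × ℝ => F t x.2) (univ ×ˢ Ioi 0) := fun hF =>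
    hF.comp (f := fun x : ℝ × ℝ => (t, x.2)) (by fun_prop) fun x hx => ⟨mem_univ _, hx.2⟩
  have ht := mem_univ t
  have hs' := mem_univ s
  have h1 := hs.slice_u hs'
  have h2 := hs.slice_p hs'
  have h3 := hj.slice_u ht
  have h4 := hj.slice_p ht
  have h5 := hs.slice_qq hs'
  have h6 := hs.slice_q hs'
  have h7 := hj.slice_q ht
  have h8 := hs.slice_pp hs'
  refine ⟨_, hχ.hasDerivAt_integral (I := univ) isOpen_univ
    (D := fun s r => r * (p (t + s) r * u t r - u (t + s) r * p t r))
    (D' := fun s r => r * (pp (t + s) r * u t r - p (t + s) r * p t r))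
    (fun s hs' r hr => ?_) (fun s hs' => ?_) ?_ hs', ?_⟩
  · have h1 := hs.dt s hs' r hr
    have h2 := hs.dtt s hs' r hr
    exact ((h2.mul_const _).sub (h1.mul_const _)).const_mul r
  · have h1 := hs.slice_u hs'
    have h2 := hs.slice_p hs'
    exact continuousOn_id.mul ((h2.mul h3).sub (h1.mul h4))
  · exact continuousOn_snd.mul ((hs.cpp.mul (key hj.cu)).sub (hs.cp.mul (key hj.cp)))
  · rw [← integral_add (hχ.integrableOn_mul (F := fun r =>
      r * (pp (t + s) r * u t r - p (t + s) r * p t r))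
        (continuousOn_id.mul ((h8.mul h3).sub (h2.mul h4))))
      (hχ.integrableOn_mul (h.continuousOn_linBil _ _))]
    have e : ∀ r ∈ Ioi (0 : ℝ), χ r * (r * (pp (t + s) r * u t r - p (t + s) r * p t r)) +
        χ r * linBil u p q (t + s) t r =
        χ r * (1 * (q (t + s) r * u t r) + r * (qq (t + s) r * u t r + q (t + s) r * q t r)) := by
      intro r hr
      have hr0 : r ≠ 0 := ne_of_gt hr
      rw [h.eqn _ _ hr]
      unfold linBil
      field_simp
      ring
    rw [setIntegral_congr_fun measurableSet_Ioi e, ← integral_add (h.fin _) (h.fin _)]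
    refine hχ.abs_integral_mul_deriv_le
      (P := fun r => r * (q (t + s) r * u t r)) (fun r hr => ?_) ?_
      ((h.fin _).add (h.fin _)) (fun r hr => abs_mul_le_linDen u p q (t + s) t hr)
    · exact (hasDerivAt_id r).mul ((hs.drr s hs' r hr).mul (hj.dr t ht r hr))
    · exact (continuousOn_const.mul (h6.mul h3)).add
        (continuousOn_id.mul ((h5.mul h3).add (h6.mul h7)))

/-- Weak continuity in time, uniformly in the cutoff. -/
theorem exists_abs_integral_linBil_sub_le (h : IsLinSol u p q pp pq qq)
    {χ χ' : ℕ → ℝ → ℝ} {ε a b : ℕ → ℝ}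
    (hχ : ∀ n : ℕ, IsLogCutoff (ε n) (a n) (b n) (χ n) (χ' n))
    (hlim : ∀ r, 0 < r → Tendsto (fun n => χ n r) atTop (nhds 1)) (t K : ℝ) (hK : 0 ≤ K) {η : ℝ}
    (hη : 0 < η) : ∃ m : ℕ, ∃ δ > 0, ∀ n, m ≤ n → ∀ s, |s| ≤ δ →
      ∫ r in Ioi 0, linDen u p q (t + s) r ≤ K →
      |(∫ r in Ioi 0, χ n r * linBil u p q (t + s) t r) - ∫ r in Ioi 0, linDen u p q t r| ≤ η := by
  set E := ∫ r in Ioi 0, linDen u p q t r with hE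
  let θ := η / (4 * (K + 1))
  have hθ : 0 < θ := by positivity
  have hθK : θ * K ≤ η / 4 := by
    simp only [θ]; rw [div_mul_eq_mul_div, div_le_div_iff₀ (by positivity) (by positivity)]
    nlinarith
  have ht1 := tendsto_integral_cutoff hχ hlim (h.fin t)
  let κ := min (η / 4) (θ * η / 8)
  have hκ : 0 < κ := by positivity
  obtain ⟨m, hm⟩ := (Metric.tendsto_atTop.1 ht1 κ hκ)
  have hc : ContinuousAt (fun s => ∫ r in Ioi 0, χ m r * linBil u p q (t + s) t r) 0 := by
    refine ContinuousAt.comp (f := fun s => t + s)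
      (g := fun s => ∫ r in Ioi 0, χ m r * linBil u p q s t r) ?_ (by fun_prop)
    exact (h.hasDerivAt_linBil (hχ m) t _).continuousAt
  obtain ⟨δ, hδ, hd⟩ := Metric.continuousAt_iff.1 hc (η / 4) (by positivity)
  refine ⟨m, δ / 2, by positivity, fun n hn s hs hEs => ?_⟩
  have hd' := hd (x := s) (by rw [Real.dist_eq, sub_zero]; linarith)
  rw [Real.dist_eq, add_zero] at hd'
  simp only [linBil_self] at hd'
  have hmm := hm m le_rfl
  have hnn := hm n hn
  rw [Real.dist_eq] at hmm hnn
  have hk1 : κ ≤ η / 4 := min_le_left _ _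
  have hk2 : κ ≤ θ * η / 8 := min_le_right _ _
  have I1 : ∀ n, IntegrableOn (fun r => χ n r * linBil u p q (t + s) t r) (Ioi 0) := fun n =>
    (hχ n).integrableOn_mul (h.continuousOn_linBil _ _)
  have I2 : ∀ n, IntegrableOn (fun r => χ n r * linDen u p q t r) (Ioi 0) := fun n =>
    (hχ n).integrableOn_mul (h.continuousOn_linDen _)
  have J : ∀ n, IntegrableOn (fun r => linDen u p q t r - χ n r * linDen u p q t r) (Ioi 0) :=
    fun n => (h.fin t).sub (I2 n)
  have J2 : IntegrableOn (fun r => θ⁻¹ * ((linDen u p q t r - χ n r * linDen u p q t r) +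
      (linDen u p q t r - χ m r * linDen u p q t r))) (Ioi 0) := ((J n).add (J m)).const_mul _
  have hdiff : |(∫ r in Ioi 0, χ n r * linBil u p q (t + s) t r) -
      ∫ r in Ioi 0, χ m r * linBil u p q (t + s) t r| ≤ η / 2 := by
    rw [← integral_sub (I1 n) (I1 m), ← Real.norm_eq_abs]
    have hI : IntegrableOn (fun r => θ * linDen u p q (t + s) r +
        θ⁻¹ * ((linDen u p q t r - χ n r * linDen u p q t r) +
          (linDen u p q t r - χ m r * linDen u p q t r))) (Ioi 0) :=
      ((h.fin _).const_mul θ).add J2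
    refine (norm_integral_le_of_norm_le hI
      ((ae_restrict_iff' measurableSet_Ioi).2 (Eventually.of_forall fun r hr => ?_))).trans ?_
    · rw [← sub_mul, Real.norm_eq_abs, abs_mul]
      have hb := abs_linBil_le u p q (t + s) t hθ hr
      have hp1 := linDen_nonneg u p q t hr
      have hp2 := linDen_nonneg u p q (t + s) hr
      have a1 : |χ n r - χ m r| ≤ 1 := by
        rw [abs_le]; constructor <;> linarith [(hχ n).nonneg r, (hχ m).nonneg r, (hχ n).le_one r,
          (hχ m).le_one r]
      have a2 : |χ n r - χ m r| ≤ (1 - χ n r) + (1 - χ m r) := by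
        rw [abs_le]; constructor <;> linarith [(hχ n).nonneg r, (hχ m).nonneg r, (hχ n).le_one r,
          (hχ m).le_one r]
      calc |χ n r - χ m r| * |linBil u p q (t + s) t r|
          ≤ |χ n r - χ m r| * (θ * linDen u p q (t + s) r + θ⁻¹ * linDen u p q t r) := by gcongr
        _ = |χ n r - χ m r| * (θ * linDen u p q (t + s) r) +
            |χ n r - χ m r| * (θ⁻¹ * linDen u p q t r) := by ring
        _ ≤ 1 * (θ * linDen u p q (t + s) r) +
            ((1 - χ n r) + (1 - χ m r)) * (θ⁻¹ * linDen u p q t r) := by gcongr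
        _ = _ := by ring
    · rw [integral_add ((h.fin _).const_mul θ) J2,
        integral_const_mul, integral_const_mul,
        integral_add (J n) (J m),
        integral_sub (h.fin t) (I2 n), integral_sub (h.fin t) (I2 m)]
      rw [abs_lt] at hmm hnn
      have : θ⁻¹ * ((E - ∫ r in Ioi 0, χ n r * linDen u p q t r) +
          (E - ∫ r in Ioi 0, χ m r * linDen u p q t r)) ≤ θ⁻¹ * (θ * η / 4) := by
        gcongr; linarith
      have e : θ⁻¹ * (θ * η / 4) = η / 4 := by field_simp
      have : θ * (∫ r in Ioi 0, linDen u p q (t + s) r) ≤ θ * K := by gcongr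
      linarith
  rw [abs_le] at hdiff ⊢
  rw [abs_lt] at hd' hmm
  constructor <;> linarith

theorem energy_eq_of_common_shift (h : IsLinSol u p q pp pq qq) {α β K d t t' : ℝ} (hK : 0 ≤ K)
    (hbd : ∀ s ∈ Icc α β, ∫ r in Ioi 0, linDen u p q s r ≤ K) (ht : t ∈ Icc α β)
    (ht' : t' ∈ Icc α β) (hd : d ≠ 0)
    (hs : ∀ s ∈ uIcc 0 d, t + s ∈ Icc α β ∧ t' + s ∈ Icc α β) :
    ∫ r in Ioi 0, linDen u p q t r = ∫ r in Ioi 0, linDen u p q t' r := by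
  obtain ⟨χ, χ', a, b, hχ, hlim⟩ := exists_logCutoff
  refine eq_of_forall_dist_le fun η hη => ?_
  rw [Real.dist_eq]
  obtain ⟨m, δ, hδ, hm⟩ := h.exists_abs_integral_linBil_sub_le hχ hlim t K hK (half_pos hη)
  obtain ⟨m', δ', hδ', hm'⟩ := h.exists_abs_integral_linBil_sub_le hχ hlim t' K hK (half_pos hη)
  obtain ⟨c, hc, hcd, hc1, hc2⟩ : ∃ c, c ≠ 0 ∧ c ∈ uIcc 0 d ∧ |c| ≤ δ ∧ |c| ≤ δ' := by
    have hd' : 0 < |d| := abs_pos.2 hd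
    let x := min 1 (min (δ / |d|) (δ' / |d|))
    have hx : 0 < x := by positivity
    have hx1 : x ≤ 1 := min_le_left _ _
    have hxd : |x * d| = x * |d| := by rw [abs_mul, abs_of_pos hx]
    refine ⟨x * d, mul_ne_zero hx.ne' hd, ?_, ?_, ?_⟩
    · rcases le_total 0 d with h0 | h0
      · rw [uIcc_of_le h0]; constructor <;> nlinarith
      · rw [uIcc_of_ge h0]; constructor <;> nlinarith
    · rw [hxd, ← le_div_iff₀ hd']
      exact (min_le_right _ _).trans (min_le_left _ _)
    · rw [hxd, ← le_div_iff₀ hd']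
      exact (min_le_right _ _).trans (min_le_right _ _)
  have hsub : uIcc 0 c ⊆ uIcc 0 d := uIcc_subset_uIcc left_mem_uIcc hcd
  have habs : ∀ s ∈ uIcc 0 c, |s| ≤ |c| := fun s hs => by
    simpa using abs_sub_left_of_mem_uIcc hs
  let W : ℕ → ℝ → ℝ → ℝ := fun n s t =>
    ∫ r in Ioi 0, χ n r * (r * (p (t + s) r * u t r - u (t + s) r * p t r))
  -- the symplectic form is `-c E(t)` up to small errors
  have hW : ∀ (τ ρ : ℝ) (k : ℕ), τ ∈ Icc α β → (∀ s ∈ uIcc 0 d, τ + s ∈ Icc α β) → |c| ≤ ρ →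
      (∀ n, k ≤ n → ∀ s, |s| ≤ ρ → ∫ r in Ioi 0, linDen u p q (τ + s) r ≤ K →
      |(∫ r in Ioi 0, χ n r * linBil u p q (τ + s) τ r) -
        ∫ r in Ioi 0, linDen u p q τ r| ≤ η / 2) → ∀ n, k ≤ n →
      |W n c τ + c * ∫ r in Ioi 0, linDen u p q τ r| ≤
        (η / 2 + 1 / ((n : ℝ) + 1) * (2 * K)) * |c| := by
    intro τ ρ k hτ hτs hρ hk n hn
    choose w hw hw' using fun s => h.exists_hasDerivAt_symplectic_right (hχ n) τ s
    have hmv := Convex.norm_image_sub_le_of_norm_hasDerivWithin_le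
      (f := fun s => W n s τ + s * ∫ r in Ioi 0, linDen u p q τ r)
      (f' := fun s => w s + 1 * ∫ r in Ioi 0, linDen u p q τ r) (s := uIcc 0 c) (x := 0) (y := c)
      (C := η / 2 + 1 / ((n : ℝ) + 1) * (2 * K))
      (fun s _ => ((hw s).add ((hasDerivAt_id s).mul_const _)).hasDerivWithinAt) (fun s hs => ?_)
      (convex_uIcc 0 c) left_mem_uIcc right_mem_uIcc
    · have hW0 : W n 0 τ = 0 := by
        have : ∀ r, χ n r * (r * (p (τ + 0) r * u τ r - u (τ + 0) r * p τ r)) = 0 := by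
          intro r; rw [add_zero]; ring
        simp only [W, this, integral_zero]
      simpa [hW0] using hmv
    · have hK1 := hbd _ (hτs s (hsub hs))
      have hK2 := hbd _ hτ
      have k1 := hk n hn s ((habs s hs).trans hρ) hK1
      have k2 := hw' s
      have k3 : 1 / ((n : ℝ) + 1) * ((∫ r in Ioi 0, linDen u p q (τ + s) r) +
        ∫ r in Ioi 0, linDen u p q τ r) ≤ 1 / ((n : ℝ) + 1) * (2 * K) :=
        mul_le_mul_of_nonneg_left (by linarith) (by positivity)
      rw [Real.norm_eq_abs, one_mul]
      rw [abs_le] at k1 k2 ⊢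
      constructor <;> linarith
  have hWt : ∀ n, |W n c t - W n c t'| ≤ 1 / ((n : ℝ) + 1) * (4 * K) * |t - t'| := by
    intro n
    choose w hw hw' using fun τ => h.exists_hasDerivAt_symplectic_left (hχ n) c τ
    have hmem : ∀ τ ∈ uIcc t' t, τ ∈ Icc α β ∧ c + τ ∈ Icc α β := by
      intro τ hτ
      obtain ⟨h1, h2⟩ := hs c hcd
      have hsub1 : uIcc t' t ⊆ Icc α β := uIcc_subset_Icc ht' ht
      refine ⟨hsub1 hτ, ?_⟩
      rw [mem_uIcc] at hτ
      rcases hτ with hτ | hτ <;> exact ⟨by linarith [h1.1, h2.1], by linarith [h1.2, h2.2]⟩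
    have hmv := Convex.norm_image_sub_le_of_norm_hasDerivWithin_le
      (f := fun τ => ∫ r in Ioi 0, χ n r * (r * (p (c + τ) r * u τ r - u (c + τ) r * p τ r)))
      (f' := w) (s := uIcc t' t) (x := t') (y := t)
      (C := 1 / ((n : ℝ) + 1) * (4 * K))
      (fun s _ => (hw s).hasDerivWithinAt) (fun s hs => ?_)
      (convex_uIcc t' t) left_mem_uIcc right_mem_uIcc
    · simpa only [W, add_comm _ c, Real.norm_eq_abs] using hmv
    · rw [Real.norm_eq_abs]
      refine (hw' s).trans ?_
      have k1 := hbd _ (hmem s hs).1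
      have k2 := hbd _ (hmem s hs).2
      refine mul_le_mul_of_nonneg_left ?_ (by positivity)
      linarith
  set E := ∫ r in Ioi 0, linDen u p q t r
  set E' := ∫ r in Ioi 0, linDen u p q t' r
  have hfin : ∀ n, max m m' ≤ n →
      |c| * |E - E'| ≤ η * |c| + 1 / ((n : ℝ) + 1) * (4 * K * |c| + 4 * K * |t - t'|) := by
    intro n hn
    have k1 := hW t δ m ht (fun s h => (hs s h).1) hc1 hm n ((le_max_left _ _).trans hn)
    have k2 := hW t' δ' m' ht' (fun s h => (hs s h).2) hc2 hm' n ((le_max_right _ _).trans hn)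
    have k3 := hWt n
    rw [← abs_mul]
    have e : c * (E - E') = (W n c t + c * E) - (W n c t' + c * E') - (W n c t - W n c t') := by
      ring
    rw [e]
    refine (abs_sub _ _).trans ?_
    have := abs_sub (W n c t + c * E) (W n c t' + c * E')
    linarith
  have hl : Tendsto (fun n : ℕ => η * |c| + 1 / ((n : ℝ) + 1) * (4 * K * |c| + 4 * K * |t - t'|))
      atTop (nhds (η * |c| + 0 * (4 * K * |c| + 4 * K * |t - t'|))) :=
    (tendsto_one_div_add_atTop_nhds_zero_nat.mul_const _).const_add _
  have hle := ge_of_tendsto hl ((eventually_ge_atTop (max m m')).mono fun n hn => hfin n hn)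
  have hc' : 0 < |c| := abs_pos.2 hc
  rw [zero_mul, add_zero, mul_comm η] at hle
  exact le_of_mul_le_mul_left hle hc'

theorem energy_eq_of_bounded (h : IsLinSol u p q pp pq qq) {α β K : ℝ} (hαβ : α < β) (hK : 0 ≤ K)
    (hbd : ∀ s ∈ Icc α β, ∫ r in Ioi 0, linDen u p q s r ≤ K) :
    ∫ r in Ioi 0, linDen u p q α r = ∫ r in Ioi 0, linDen u p q β r := by
  trans ∫ r in Ioi 0, linDen u p q ((α + β) / 2) r
  · refine h.energy_eq_of_common_shift (d := (β - α) / 2) hK hbd ⟨le_rfl, hαβ.le⟩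
      ⟨by linarith, by linarith⟩ (by linarith) fun s hs => ?_
    rw [uIcc_of_le (by linarith)] at hs
    exact ⟨⟨by linarith [hs.1], by linarith [hs.2]⟩, ⟨by linarith [hs.1], by linarith [hs.2]⟩⟩
  · refine h.energy_eq_of_common_shift (d := (α - β) / 2) hK hbd
      ⟨by linarith, by linarith⟩ ⟨hαβ.le, le_rfl⟩ (by linarith) fun s hs => ?_
    rw [uIcc_of_ge (by linarith)] at hs
    exact ⟨⟨by linarith [hs.1], by linarith [hs.2]⟩, ⟨by linarith [hs.1], by linarith [hs.2]⟩⟩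

end IsLinSol

/-- A lower semicontinuous function that is constant on intervals where it is bounded above is
constant. -/
theorem eq_of_isClosed_of_eq_of_bounded {E : ℝ → ℝ} (hcl : ∀ N : ℝ, IsClosed {t | E t ≤ N})
    (hE : ∀ α β K, α ≤ β → (∀ s ∈ Icc α β, E s ≤ K) → E α = E β) (t t' : ℝ) : E t = E t' := by
  let G : Set ℝ := ⋃ K : ℝ, interior {t | E t ≤ K}
  have hG : IsOpen G := isOpen_iUnion fun K => isOpen_interior
  have hGE : ∀ α β, α ≤ β → Icc α β ⊆ G → E α = E β := by
    intro α β hαβ hsub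
    have : ∃ K, ∀ s ∈ Icc α β, E s ≤ K := by
      refine isCompact_Icc.induction_on (p := fun S => ∃ K, ∀ s ∈ S, E s ≤ K) ⟨0, by simp⟩
        (fun S T hST ⟨K, hK⟩ => ⟨K, fun s hs => hK s (hST hs)⟩) ?_ ?_
      · rintro S T ⟨K, hK⟩ ⟨K', hK'⟩
        exact ⟨max K K', fun s hs => hs.elim (fun h => (hK s h).trans (le_max_left _ _))
          fun h => (hK' s h).trans (le_max_right _ _)⟩
      · intro x hx
        obtain ⟨K, hK⟩ := mem_iUnion.1 (hsub hx)
        exact ⟨_, mem_nhdsWithin_of_mem_nhds (mem_interior_iff_mem_nhds.1 hK), K, fun s hs => hs⟩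
    obtain ⟨K, hK⟩ := this
    exact hE α β K hαβ hK
  suffices hu : G = univ by
    rcases le_total t t' with h | h
    · exact hGE _ _ h (hu ▸ subset_univ _)
    · exact (hGE _ _ h (hu ▸ subset_univ _)).symm
  by_contra hne
  have hF : IsClosed Gᶜ := hG.isClosed_compl
  have hFne : (Gᶜ).Nonempty := nonempty_compl.2 hne
  have : Nonempty ↥Gᶜ := hFne.to_subtype
  have : CompleteSpace ↥Gᶜ := hF.completeSpace_coe
  obtain ⟨N, ⟨⟨x, hx⟩, hxN⟩⟩ := nonempty_interior_of_iUnion_of_closed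
    (f := fun N : ℕ => {x : ↥Gᶜ | E x ≤ N})
    (fun N => (hcl N).preimage continuous_subtype_val) (by
      refine eq_univ_of_forall fun x => mem_iUnion.2 ?_
      exact exists_nat_ge (E x))
  obtain ⟨δ, hδ, hball⟩ := Metric.mem_nhds_iff.1 (mem_interior_iff_mem_nhds.1 hxN)
  have hN : ∀ y, y ∉ G → |y - x| < δ → E y ≤ N := fun y hy hyx =>
    hball (show (⟨y, hy⟩ : ↥Gᶜ) ∈ Metric.ball _ _ from hyx)
  refine hx (mem_iUnion.2 ⟨N, mem_interior_iff_mem_nhds.2 (Metric.mem_nhds_iff.2 ⟨δ, hδ, ?_⟩)⟩)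
  intro s hs
  rw [Metric.mem_ball, Real.dist_eq] at hs
  show E s ≤ N
  by_cases hsG : s ∉ G
  · exact hN s hsG hs
  push Not at hsG
  rw [abs_lt] at hs
  rcases le_total x s with hxs | hxs
  · have hcomp : IsCompact (Gᶜ ∩ Icc x s) := isCompact_Icc.inter_left hF
    obtain ⟨y, hy, hmax⟩ := hcomp.exists_isGreatest ⟨x, hx, le_rfl, hxs⟩
    have hyN : E y ≤ N := hN y hy.1 (by rw [abs_lt]; constructor <;> linarith [hy.2.1, hy.2.2])
    have hc : ∀ z ∈ Ioc y s, E z = E s := fun z hz => hGE z s hz.2 fun w hw => by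
      by_contra hwG
      linarith [hmax ⟨hwG, hy.2.1.trans (hz.1.le.trans hw.1), hw.2⟩, hw.1, hz.1]
    rw [← hE y s (max N (E s)) hy.2.2 fun z hz => ?_]
    · exact hyN
    · rcases hz.1.eq_or_lt with h | h
      · rw [← h]; exact hyN.trans (le_max_left _ _)
      · rw [hc z ⟨h, hz.2⟩]; exact le_max_right _ _
  · have hcomp : IsCompact (Gᶜ ∩ Icc s x) := isCompact_Icc.inter_left hF
    obtain ⟨y, hy, hmin⟩ := hcomp.exists_isLeast ⟨x, hx, hxs, le_rfl⟩
    have hyN : E y ≤ N := hN y hy.1 (by rw [abs_lt]; constructor <;> linarith [hy.2.1, hy.2.2])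
    have hc : ∀ z ∈ Ico s y, E z = E s := fun z hz => (hGE s z hz.1 fun w hw => by
      by_contra hwG
      linarith [hmin ⟨hwG, hw.1, (hw.2.trans hz.2.le).trans hy.2.2⟩, hw.2, hz.2]).symm
    rw [hE s y (max N (E s)) hy.2.1 fun z hz => ?_]
    · exact hyN
    · rcases hz.2.eq_or_lt with h | h
      · rw [h]; exact hyN.trans (le_max_left _ _)
      · rw [hc z ⟨hz.1, h⟩]; exact le_max_right _ _

namespace IsLinSol

variable {u p q pp pq qq : ℝ → ℝ → ℝ}

theorem hasDerivAt_linDen (h : IsLinSol u p q pp pq qq) {ε a b : ℝ} {χ χ' : ℝ → ℝ}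
    (hχ : IsLogCutoff ε a b χ χ') (s : ℝ) :
    HasDerivAt (fun s => ∫ r in Ioi 0, χ r * linDen u p q s r)
      (∫ r in Ioi 0, χ r * (2 * (pp s r * p s r + pq s r * q s r + p s r * u s r / r ^ 2) * r))
      s := by
  refine hχ.hasDerivAt_integral (I := univ) isOpen_univ
    (D := fun s => linDen u p q s)
    (D' := fun s r => 2 * (pp s r * p s r + pq s r * q s r + p s r * u s r / r ^ 2) * r)
    (fun s hs r hr => ?_) (fun s _ => h.continuousOn_linDen s) ?_ (mem_univ s)
  · have h1 := h.jet.dt s hs r hr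
    have h2 := h.jet.dtt s hs r hr
    have h3 := h.jet.drt s hs r hr
    exact ((((h2.pow 2).add (h3.pow 2)).add ((h1.pow 2).div_const _)).mul_const r).congr_deriv
      (by push_cast; ring)
  · have h1 := h.jet.cp
    have h2 := h.jet.cpp
    have h3 := h.jet.cpq
    have h4 := h.jet.cu
    have h6 := h.jet.cq
    exact (continuousOn_const.mul (((h2.mul h1).add (h3.mul h6)).add
      ((h1.mul h4).div (continuousOn_snd.pow 2)
      fun x hx => pow_ne_zero _ (ne_of_gt hx.2)))).mul continuousOn_snd

theorem isClosed_energy_le (h : IsLinSol u p q pp pq qq) (N : ℝ) :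
    IsClosed {t | ∫ r in Ioi 0, linDen u p q t r ≤ N} := by
  obtain ⟨χ, χ', a, b, hχ, hlim⟩ := exists_logCutoff
  have e : {t | ∫ r in Ioi 0, linDen u p q t r ≤ N} =
      ⋂ n, {t | ∫ r in Ioi 0, χ n r * linDen u p q t r ≤ N} := by
    ext t
    rw [mem_iInter]
    refine ⟨fun ht n => ?_, fun ht => ?_⟩
    · refine le_trans (setIntegral_mono_on ((hχ n).integrableOn_mul (h.continuousOn_linDen _))
        (h.fin t) measurableSet_Ioi fun r hr => ?_) ht
      exact mul_le_of_le_one_left (linDen_nonneg u p q t hr) ((hχ n).le_one r)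
    · exact le_of_tendsto (tendsto_integral_cutoff hχ hlim (h.fin t)) (Eventually.of_forall ht)
  rw [e]
  refine isClosed_iInter fun n => isClosed_le ?_ continuous_const
  exact continuous_iff_continuousAt.2 fun t => (h.hasDerivAt_linDen (hχ n) t).continuousAt

theorem energy_eq (h : IsLinSol u p q pp pq qq) (t t' : ℝ) :
    ∫ r in Ioi 0, linDen u p q t r = ∫ r in Ioi 0, linDen u p q t' r := by
  refine eq_of_isClosed_of_eq_of_bounded (E := fun t => ∫ r in Ioi 0, linDen u p q t r)
    h.isClosed_energy_le (fun α β K hαβ hK => ?_) t t'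
  rcases hαβ.eq_or_lt with rfl | hlt
  · rfl
  · exact h.energy_eq_of_bounded hlt
      ((setIntegral_linDen_nonneg u p q α).trans (hK α ⟨le_rfl, hαβ⟩)) hK

end IsLinSol

/-- An even weight `f` vanishing at `0`, with derivatives `f₁`, `f₂`, and its restriction `g` to the
positive half line, with derivative `g₁`, subject to the inequalities that make the associated
multiplier identity for the linear equation monotone. -/
structure IsWeight (f f₁ f₂ g g₁ : ℝ → ℝ) : Prop where
  hasDerivAt : ∀ s, HasDerivAt f (f₁ s) s
  hasDerivAt' : ∀ s, HasDerivAt f₁ (f₂ s) s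
  hasDerivAt_pos : ∀ s, HasDerivAt g (g₁ s) s
  continuous : Continuous f₂
  continuous_pos : Continuous g₁
  zero : f 0 = 0
  neg : ∀ s, f (-s) = f s
  deriv_neg : ∀ s, f₁ (-s) = -f₁ s
  le_one : ∀ s, f s ≤ 1
  abs_deriv_le : ∀ s, |f₁ s| ≤ 1
  deriv_nonneg : ∀ s, 0 ≤ s → 0 ≤ f₁ s
  abs_sub_le : ∀ s s', |f s - f s'| ≤ |s - s'|
  mono : ∀ s s', |s| ≤ |s'| → f s ≤ f s'
  pos_eq : ∀ s, g s = f (max s 0)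
  deriv_pos_nonneg : ∀ s, 0 ≤ g₁ s
  bracket_le : ∀ t r, 0 ≤ t → 0 < r →
    f₁ (t + r) + f₁ (t - r) - (f (t + r) - f (t - r)) / r ≤ g₁ (t - r)

/-- The weight `s² / (k + s²)`. -/
def ratWeight (k s : ℝ) : ℝ := s ^ 2 / (k + s ^ 2)

/-- First derivative of `ratWeight`. -/
def ratWeight' (k s : ℝ) : ℝ := 2 * k * s / (k + s ^ 2) ^ 2

/-- Second derivative of `ratWeight`. -/
def ratWeight'' (k s : ℝ) : ℝ := 2 * k * (k - 3 * s ^ 2) / (k + s ^ 2) ^ 3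

section RatWeight

variable {k : ℝ}

theorem hasDerivAt_ratWeight (hk : 0 < k) (s : ℝ) :
    HasDerivAt (ratWeight k) (ratWeight' k s) s := by
  have h0 : k + s ^ 2 ≠ 0 := by positivity
  have h1 : HasDerivAt (fun s : ℝ => s ^ 2) (2 * s) s := by simpa using hasDerivAt_pow 2 s
  refine (h1.div (h1.const_add k) h0).congr_deriv ?_
  unfold ratWeight'
  congr 1
  ring

theorem hasDerivAt_ratWeight' (hk : 0 < k) (s : ℝ) :
    HasDerivAt (ratWeight' k) (ratWeight'' k s) s := by
  have h0 : k + s ^ 2 ≠ 0 := by positivity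
  have h1 : HasDerivAt (fun s : ℝ => s ^ 2) (2 * s) s := by simpa using hasDerivAt_pow 2 s
  refine (((hasDerivAt_id s).const_mul (2 * k)).div ((h1.const_add k).pow 2)
    (pow_ne_zero 2 h0)).congr_deriv ?_
  unfold ratWeight''
  simp only [id, Pi.pow_apply]
  field_simp
  ring

theorem abs_ratWeight'_le (hk : 1 ≤ k) (s : ℝ) : |ratWeight' k s| ≤ 1 := by
  unfold ratWeight'
  have h0 : 0 < (k + s ^ 2) ^ 2 := by positivity
  rw [abs_div, abs_of_pos h0, div_le_one h0, abs_le]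
  constructor <;> nlinarith [sq_nonneg (s - 1), sq_nonneg (s + 1), sq_nonneg s,
    mul_nonneg (by linarith : 0 ≤ k) (sq_nonneg (s - 1)), sq_nonneg (s ^ 2),
    mul_nonneg (by linarith : 0 ≤ k) (sq_nonneg (s + 1))]

theorem ratWeight_mono (hk : 0 < k) {s s' : ℝ} (h : |s| ≤ |s'|) :
    ratWeight k s ≤ ratWeight k s' := by
  have := sq_le_sq.2 h
  unfold ratWeight
  rw [div_le_div_iff₀ (by positivity) (by positivity)]
  nlinarith

theorem ratWeight'_nonneg (hk : 0 < k) {s : ℝ} (hs : 0 ≤ s) : 0 ≤ ratWeight' k s := by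
  unfold ratWeight'; positivity

theorem continuous_ratWeight' (hk : 0 < k) : Continuous (ratWeight' k) :=
  continuous_iff_continuousAt.2 fun s => (hasDerivAt_ratWeight' hk s).continuousAt

theorem hasDerivAt_ratWeight_max (hk : 0 < k) (s : ℝ) :
    HasDerivAt (fun s => ratWeight k (max s 0)) (ratWeight' k (max s 0)) s := by
  have hz : ratWeight' k 0 = 0 := by simp [ratWeight']
  rcases lt_trichotomy s 0 with h | h | h
  · rw [max_eq_right h.le, hz]
    refine (hasDerivAt_const s (ratWeight k 0)).congr_of_eventuallyEq ?_
    filter_upwards [gt_mem_nhds h] with x hx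
    rw [max_eq_right hx.le]
  · subst h
    rw [max_self, hz]
    refine hasDerivAt_iff_isLittleO.2 ?_
    have h1 := hasDerivAt_iff_isLittleO.1 (hasDerivAt_ratWeight hk 0)
    refine Asymptotics.IsBigO.trans_isLittleO (Asymptotics.IsBigO.of_bound 1 ?_) h1
    refine Eventually.of_forall fun x => ?_
    rw [hz, max_self]
    have h0 : ratWeight k 0 = 0 := by simp [ratWeight]
    have hp : ∀ y, 0 ≤ ratWeight k y := fun y => by unfold ratWeight; positivity
    simp only [h0, smul_zero, sub_zero, one_mul, Real.norm_eq_abs, abs_of_nonneg (hp _)]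
    refine ratWeight_mono hk ?_
    rw [abs_of_nonneg (le_max_right x 0)]
    exact max_le (le_abs_self x) (abs_nonneg x)
  · rw [max_eq_left h.le]
    refine (hasDerivAt_ratWeight hk s).congr_of_eventuallyEq ?_
    filter_upwards [lt_mem_nhds h] with x hx
    rw [max_eq_left hx.le]

theorem ratWeight_bracket_le (hk : 0 < k) {t r : ℝ} (ht : 0 ≤ t) (hr : 0 < r) :
    ratWeight' k (t + r) + ratWeight' k (t - r) - (ratWeight k (t + r) - ratWeight k (t - r)) / r ≤
      ratWeight' k (max (t - r) 0) := by
  set v := t + r with hv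
  set w := t - r with hw
  have ha : 0 < k + w ^ 2 := by positivity
  have hb : 0 < k + v ^ 2 := by positivity
  have hab : k + w ^ 2 ≤ k + v ^ 2 := by simp only [hv, hw]; nlinarith [mul_nonneg ht hr.le]
  have hv0 : 0 < v := by linarith
  have hvw : 0 ≤ v + w := by linarith
  have e : (ratWeight k v - ratWeight k w) / r =
      2 * k * (v + w) / ((k + w ^ 2) * (k + v ^ 2)) := by
    have hr2 : r = (v - w) / 2 := by simp only [hv, hw]; ring
    have hvw' : v - w ≠ 0 := by simp only [hv, hw]; linarith
    rw [hr2]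
    unfold ratWeight
    field_simp
    ring
  rw [e]
  rcases le_total w 0 with hw0 | hw0
  · rw [max_eq_right hw0]
    have hz : ratWeight' k 0 = 0 := by simp [ratWeight']
    rw [hz]
    have e2 : ratWeight' k v + ratWeight' k w - 2 * k * (v + w) / ((k + w ^ 2) * (k + v ^ 2)) =
        -(2 * k * (((v * (k + w ^ 2) + -w * (k + v ^ 2)) * ((k + v ^ 2) - (k + w ^ 2))) /
          ((k + w ^ 2) ^ 2 * (k + v ^ 2) ^ 2))) := by
      unfold ratWeight'
      field_simp
      ring
    rw [e2, neg_nonpos]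
    have h1 : 0 ≤ -w := by linarith
    have h2 : 0 ≤ (k + v ^ 2) - (k + w ^ 2) := by linarith
    positivity
  · rw [max_eq_left hw0]
    have : ratWeight' k v ≤ 2 * k * (v + w) / ((k + w ^ 2) * (k + v ^ 2)) := by
      unfold ratWeight'
      rw [div_le_div_iff₀ (by positivity) (by positivity)]
      have : v * (k + w ^ 2) ≤ (v + w) * (k + v ^ 2) := by gcongr; linarith
      calc 2 * k * v * ((k + w ^ 2) * (k + v ^ 2)) = 2 * k * (k + v ^ 2) * (v * (k + w ^ 2)) := by
            ring
        _ ≤ 2 * k * (k + v ^ 2) * ((v + w) * (k + v ^ 2)) := by gcongr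
        _ = _ := by ring
    linarith

theorem isWeight_ratWeight (hk : 1 ≤ k) :
    IsWeight (ratWeight k) (ratWeight' k) (ratWeight'' k) (fun s => ratWeight k (max s 0))
      (fun s => ratWeight' k (max s 0)) := by
  have hk0 : 0 < k := by linarith
  refine ⟨hasDerivAt_ratWeight hk0, hasDerivAt_ratWeight' hk0, hasDerivAt_ratWeight_max hk0, ?_,
    (continuous_ratWeight' hk0).comp (by fun_prop), by simp [ratWeight],
    fun s => by simp [ratWeight], fun s => by simp [ratWeight', neg_div], fun s => ?_,
    abs_ratWeight'_le hk, fun s hs => ratWeight'_nonneg hk0 hs, fun s s' => ?_,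
    fun s s' h => ratWeight_mono hk0 h, fun s => rfl,
    fun s => ratWeight'_nonneg hk0 (le_max_right _ _),
    fun t r ht hr => ratWeight_bracket_le hk0 ht hr⟩
  · unfold ratWeight''
    exact Continuous.div (by fun_prop) (by fun_prop) fun s => by positivity
  · unfold ratWeight
    rw [div_le_one (by positivity)]
    linarith
  · have := Convex.norm_image_sub_le_of_norm_hasDerivWithin_le (f := ratWeight k)
      (f' := ratWeight' k) (s := univ) (x := s') (y := s) (C := 1)
      (fun x _ => (hasDerivAt_ratWeight hk0 x).hasDerivWithinAt)
      (fun x _ => abs_ratWeight'_le hk x) convex_univ (mem_univ _) (mem_univ _)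
    simpa using this

end RatWeight

/-- Modified weighted energy density for the linear equation. -/
def radDen (f f₁ g : ℝ → ℝ) (u p q : ℝ → ℝ → ℝ) (t r : ℝ) : ℝ :=
  f (t + r) * (r * (p t r + q t r) ^ 2 + (u t r) ^ 2 / r)
    + f (t - r) * (r * (p t r - q t r) ^ 2 + (u t r) ^ 2 / r)
    + (f (t + r) - f (t - r)) * (u t r * p t r)
    - 1 / 2 * (u t r) ^ 2 * (f₁ (t + r) - f₁ (t - r))
    - 3 / 2 * g (t - r) * linDen u p q t r - 1 / 2 * f t * linDen u p q t r

/-- Time derivative of `radDen`. -/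
def radDen' (f f₁ f₂ g g₁ : ℝ → ℝ) (u p q pp pq : ℝ → ℝ → ℝ) (t r : ℝ) : ℝ :=
  f₁ (t + r) * (r * (p t r + q t r) ^ 2 + (u t r) ^ 2 / r)
    + f (t + r) * (2 * r * (p t r + q t r) * (pp t r + pq t r) + 2 * u t r * p t r / r)
    + f₁ (t - r) * (r * (p t r - q t r) ^ 2 + (u t r) ^ 2 / r)
    + f (t - r) * (2 * r * (p t r - q t r) * (pp t r - pq t r) + 2 * u t r * p t r / r)
    + (f (t + r) - f (t - r)) * ((p t r) ^ 2 + u t r * pp t r)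
    - 1 / 2 * (u t r) ^ 2 * (f₂ (t + r) - f₂ (t - r))
    - 3 / 2 * g₁ (t - r) * (((p t r) ^ 2 + (q t r) ^ 2 + (u t r) ^ 2 / r ^ 2) * r)
    - 1 / 2 * f₁ t * (((p t r) ^ 2 + (q t r) ^ 2 + (u t r) ^ 2 / r ^ 2) * r)
    - (3 / 2 * g (t - r) + 1 / 2 * f t) *
      (2 * (pp t r * p t r + pq t r * q t r + p t r * u t r / r ^ 2) * r)

/-- Radial flux of `radDen`. -/
def radFlux (f f₁ g : ℝ → ℝ) (u p q : ℝ → ℝ → ℝ) (t r : ℝ) : ℝ :=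
  f (t - r) * (r * (p t r - q t r) ^ 2) - f (t + r) * (r * (p t r + q t r) ^ 2)
    + (f (t - r) - f (t + r)) * (u t r * q t r - (u t r) ^ 2 / (2 * r))
    + 1 / 2 * (u t r) ^ 2 * (f₁ (t + r) + f₁ (t - r))
    + (3 * g (t - r) + f t) * (r * (p t r * q t r))

/-- Radial derivative of `radFlux`. -/
def radFlux' (f f₁ f₂ g g₁ : ℝ → ℝ) (u p q pq qq : ℝ → ℝ → ℝ) (t r : ℝ) : ℝ :=
  -f₁ (t - r) * (r * (p t r - q t r) ^ 2)
    + f (t - r) * ((p t r - q t r) ^ 2 + 2 * r * (p t r - q t r) * (pq t r - qq t r))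
    - f₁ (t + r) * (r * (p t r + q t r) ^ 2)
    - f (t + r) * ((p t r + q t r) ^ 2 + 2 * r * (p t r + q t r) * (pq t r + qq t r))
    + (-f₁ (t - r) - f₁ (t + r)) * (u t r * q t r - (u t r) ^ 2 / (2 * r))
    + (f (t - r) - f (t + r)) * ((q t r) ^ 2 + u t r * qq t r - u t r * q t r / r
      + (u t r) ^ 2 / (2 * r ^ 2))
    + u t r * q t r * (f₁ (t + r) + f₁ (t - r))
    + 1 / 2 * (u t r) ^ 2 * (f₂ (t + r) - f₂ (t - r))
    - 3 * g₁ (t - r) * (r * (p t r * q t r))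
    + (3 * g (t - r) + f t) * (p t r * q t r + r * (pq t r * q t r + p t r * qq t r))

theorem continuousOn_radDen'_aux {s : Set (ℝ × ℝ)} (hs : ∀ x ∈ s, x.2 ≠ 0) {f f₁ f₂ g g₁ : ℝ → ℝ}
    (hf : Continuous f) (hf₁ : Continuous f₁) (hf₂ : Continuous f₂) (hg : Continuous g)
    (hg₁ : Continuous g₁) {U P Q PP PQ : ℝ × ℝ → ℝ} (hU : ContinuousOn U s)
    (hP : ContinuousOn P s) (hQ : ContinuousOn Q s) (hPP : ContinuousOn PP s)
    (hPQ : ContinuousOn PQ s) :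
    ContinuousOn (fun x => radDen' f f₁ f₂ g g₁ (fun t r => U (t, r)) (fun t r => P (t, r))
      (fun t r => Q (t, r)) (fun t r => PP (t, r)) (fun t r => PQ (t, r)) x.1 x.2) s := by
  unfold radDen'
  have h1 : ∀ x ∈ s, x.2 ^ 2 ≠ 0 := fun x hx => pow_ne_zero 2 (hs x hx)
  simp only [Prod.mk.eta]
  fun_prop (disch := assumption)

section

variable {f f₁ f₂ g g₁ : ℝ → ℝ} {u p q pp pq qq : ℝ → ℝ → ℝ}

theorem IsWeight.continuous_self (hw : IsWeight f f₁ f₂ g g₁) : Continuous f :=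
  continuous_iff_continuousAt.2 fun s => (hw.hasDerivAt s).continuousAt

theorem IsWeight.continuous_deriv (hw : IsWeight f f₁ f₂ g g₁) : Continuous f₁ :=
  continuous_iff_continuousAt.2 fun s => (hw.hasDerivAt' s).continuousAt

theorem IsWeight.continuous_posPart (hw : IsWeight f f₁ f₂ g g₁) : Continuous g :=
  continuous_iff_continuousAt.2 fun s => (hw.hasDerivAt_pos s).continuousAt

theorem continuousOn_radDen' (hw : IsWeight f f₁ f₂ g g₁) (h : IsLinSol u p q pp pq qq) :
    ContinuousOn (fun x : ℝ × ℝ => radDen' f f₁ f₂ g g₁ u p q pp pq x.1 x.2) (univ ×ˢ Ioi 0) :=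
  continuousOn_radDen'_aux (U := fun x => u x.1 x.2) (P := fun x => p x.1 x.2)
    (Q := fun x => q x.1 x.2) (PP := fun x => pp x.1 x.2) (PQ := fun x => pq x.1 x.2) (fun _ hx => ne_of_gt hx.2)
    hw.continuous_self hw.continuous_deriv
    hw.continuous hw.continuous_posPart hw.continuous_pos h.jet.cu h.jet.cp h.jet.cq h.jet.cpp
    h.jet.cpq

theorem continuousOn_radDen (hw : IsWeight f f₁ f₂ g g₁) (h : IsLinSol u p q pp pq qq) (t : ℝ) :
    ContinuousOn (radDen f f₁ g u p q t) (Ioi 0) := by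
  have h1 := h.jet.slice_u (mem_univ t)
  have h2 := h.jet.slice_p (mem_univ t)
  have h3 := h.jet.slice_q (mem_univ t)
  have h4 := hw.continuous_self
  have h5 := hw.continuous_deriv
  have h6 := hw.continuous_posPart
  have h7 := h.continuousOn_linDen t
  have h0 : ∀ r ∈ Ioi (0 : ℝ), r ≠ 0 := fun r hr => ne_of_gt hr
  unfold radDen
  fun_prop (disch := assumption)

theorem continuousOn_radFlux' (hw : IsWeight f f₁ f₂ g g₁) (h : IsLinSol u p q pp pq qq) (t : ℝ) :
    ContinuousOn (radFlux' f f₁ f₂ g g₁ u p q pq qq t) (Ioi 0) := by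
  have h1 := h.jet.slice_u (mem_univ t)
  have h2 := h.jet.slice_p (mem_univ t)
  have h3 := h.jet.slice_q (mem_univ t)
  have k1 := h.jet.slice_pq (mem_univ t)
  have k2 := h.jet.slice_qq (mem_univ t)
  have h4 := hw.continuous_self
  have h5 := hw.continuous_deriv
  have h6 := hw.continuous_posPart
  have h7 := hw.continuous
  have h8 := hw.continuous_pos
  have h0 : ∀ r ∈ Ioi (0 : ℝ), r ≠ 0 := fun r hr => ne_of_gt hr
  have h01 : ∀ r ∈ Ioi (0 : ℝ), 2 * r ≠ 0 := fun r hr => mul_ne_zero two_ne_zero (h0 r hr)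
  have h02 : ∀ r ∈ Ioi (0 : ℝ), 2 * r ^ 2 ≠ 0 :=
    fun r hr => mul_ne_zero two_ne_zero (pow_ne_zero 2 (h0 r hr))
  unfold radFlux'
  fun_prop (disch := assumption)

theorem hasDerivAt_radDen (hw : IsWeight f f₁ f₂ g g₁) (h : IsLinSol u p q pp pq qq) (t : ℝ)
    {r : ℝ} (hr : 0 < r) :
    HasDerivAt (fun t => radDen f f₁ g u p q t r) (radDen' f f₁ f₂ g g₁ u p q pp pq t r) t := by
  have hu := h.jet.dt t (mem_univ t) r hr
  have hp := h.jet.dtt t (mem_univ t) r hr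
  have hq := h.jet.drt t (mem_univ t) r hr
  have fa := (hw.hasDerivAt (t + r)).comp_add_const t r
  have fb := (hw.hasDerivAt (t - r)).comp_sub_const t r
  have fa' := (hw.hasDerivAt' (t + r)).comp_add_const t r
  have fb' := (hw.hasDerivAt' (t - r)).comp_sub_const t r
  have gb := (hw.hasDerivAt_pos (t - r)).comp_sub_const t r
  have he : HasDerivAt (fun t => linDen u p q t r)
      (2 * (pp t r * p t r + pq t r * q t r + p t r * u t r / r ^ 2) * r) t :=
    ((((hp.pow 2).add (hq.pow 2)).add ((hu.pow 2).div_const _)).mul_const r).congr_deriv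
      (by push_cast; ring)
  have hu2 := (hu.pow 2).div_const r
  have m1 := fa.mul ((((hp.add hq).pow 2).const_mul r).add hu2)
  have m2 := fb.mul ((((hp.sub hq).pow 2).const_mul r).add hu2)
  have m3 := (fa.sub fb).mul (hu.mul hp)
  have m4 := ((hu.pow 2).const_mul (1 / 2)).mul (fa'.sub fb')
  have m5 := (gb.const_mul (3 / 2)).mul he
  have m6 := ((hw.hasDerivAt t).const_mul (1 / 2)).mul he
  refine (((((m1.add m2).add m3).sub m4).sub m5).sub m6).congr_deriv ?_
  unfold radDen' linDen
  simp only [Pi.add_apply, Pi.sub_apply, Pi.pow_apply, Pi.mul_apply]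
  push_cast
  ring

theorem hasDerivAt_radFlux (hw : IsWeight f f₁ f₂ g g₁) (h : IsLinSol u p q pp pq qq) (t : ℝ)
    {r : ℝ} (hr : 0 < r) :
    HasDerivAt (radFlux f f₁ g u p q t) (radFlux' f f₁ f₂ g g₁ u p q pq qq t r) r := by
  have hr0 : r ≠ 0 := hr.ne'
  have hu := h.jet.dr t (mem_univ t) r hr
  have hp := h.jet.dtr t (mem_univ t) r hr
  have hq := h.jet.drr t (mem_univ t) r hr
  have fa := (hw.hasDerivAt (t + r)).comp_const_add t r
  have fb := (hw.hasDerivAt (t - r)).comp_const_sub t r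
  have fa' := (hw.hasDerivAt' (t + r)).comp_const_add t r
  have fb' := (hw.hasDerivAt' (t - r)).comp_const_sub t r
  have gb := (hw.hasDerivAt_pos (t - r)).comp_const_sub t r
  have hi := hasDerivAt_id r
  have m1 := fb.mul (hi.mul ((hp.sub hq).pow 2))
  have m2 := fa.mul (hi.mul ((hp.add hq).pow 2))
  have m3 := (fb.sub fa).mul ((hu.mul hq).sub ((hu.pow 2).div (hi.const_mul 2)
    (mul_ne_zero two_ne_zero hr0)))
  have m4 := ((hu.pow 2).const_mul (1 / 2)).mul (fa'.add fb')
  have m5 := ((gb.const_mul 3).add_const (f t)).mul (hi.mul (hp.mul hq))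
  refine ((((m1.sub m2).add m3).add m4).add m5).congr_deriv ?_
  unfold radFlux'
  simp only [Pi.add_apply, Pi.sub_apply, Pi.pow_apply, Pi.mul_apply, Pi.div_apply, id]
  push_cast
  field_simp
  ring

theorem radDen'_add_radFlux' (h : IsLinSol u p q pp pq qq) (t : ℝ) {r : ℝ} (hr : 0 < r) :
    radDen' f f₁ f₂ g g₁ u p q pp pq t r + radFlux' f f₁ f₂ g g₁ u p q pq qq t r =
      3 * (u t r) ^ 2 / (2 * r) * (f₁ (t + r) + f₁ (t - r) - (f (t + r) - f (t - r)) / r)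
        - 3 / 2 * g₁ (t - r) * (r * (p t r + q t r) ^ 2 + (u t r) ^ 2 / r)
        - 1 / 2 * f₁ t * linDen u p q t r := by
  unfold radDen' radFlux' linDen
  rw [h.eqn t r hr]
  field_simp
  ring

end

section

variable {f f₁ f₂ g g₁ : ℝ → ℝ} {u p q pp pq qq : ℝ → ℝ → ℝ}

namespace IsWeight

theorem nonneg (hw : IsWeight f f₁ f₂ g g₁) (s : ℝ) : 0 ≤ f s := by
  have := hw.mono 0 s (by simp)
  rwa [hw.zero] at this

theorem pos_le (hw : IsWeight f f₁ f₂ g g₁) (s : ℝ) : g s ≤ f s := by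
  rw [hw.pos_eq]
  refine hw.mono _ _ ?_
  rw [abs_of_nonneg (le_max_right _ _)]
  exact max_le (le_abs_self s) (abs_nonneg s)

theorem pos_nonneg (hw : IsWeight f f₁ f₂ g g₁) (s : ℝ) : 0 ≤ g s := by
  rw [hw.pos_eq]
  exact hw.nonneg _

theorem sub_le_add (hw : IsWeight f f₁ f₂ g g₁) {t r : ℝ} (ht : 0 ≤ t) (hr : 0 < r) :
    f (t - r) ≤ f (t + r) := by
  refine hw.mono _ _ ?_
  rw [abs_of_nonneg (by linarith : 0 ≤ t + r), abs_le]
  constructor <;> linarith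

end IsWeight

theorem radDen'_add_radFlux'_le (hw : IsWeight f f₁ f₂ g g₁) (h : IsLinSol u p q pp pq qq) {t r : ℝ}
    (ht : 0 ≤ t) (hr : 0 < r) :
    radDen' f f₁ f₂ g g₁ u p q pp pq t r + radFlux' f f₁ f₂ g g₁ u p q pq qq t r ≤
      -(1 / 2 * f₁ t * linDen u p q t r) := by
  rw [radDen'_add_radFlux' h t hr]
  have h1 : 3 * (u t r) ^ 2 / (2 * r) *
      (f₁ (t + r) + f₁ (t - r) - (f (t + r) - f (t - r)) / r) ≤
      3 * (u t r) ^ 2 / (2 * r) * g₁ (t - r) :=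
    mul_le_mul_of_nonneg_left (hw.bracket_le t r ht hr) (by positivity)
  have h2 : 3 * (u t r) ^ 2 / (2 * r) * g₁ (t - r) = 3 / 2 * g₁ (t - r) * ((u t r) ^ 2 / r) := by
    field_simp
  have h3 : 0 ≤ 3 / 2 * g₁ (t - r) * (r * (p t r + q t r) ^ 2) :=
    mul_nonneg (mul_nonneg (by norm_num) (hw.deriv_pos_nonneg _)) (by positivity)
  linarith

theorem radFlux_eq {t r : ℝ} (hr : 0 < r) {V : ℝ} (hV : u t r = V * r) :
    radFlux f f₁ g u p q t r = (f (t - r) - f t) * (r * (p t r - q t r) ^ 2)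
      - (f (t + r) - f t) * (r * (p t r + q t r) ^ 2)
      + (f (t - r) - f (t + r)) * (r * (V * q t r - V ^ 2 / 2))
      + (f₁ (t + r) + f₁ (t - r)) * (r ^ 2 * (V ^ 2 / 2))
      + (g (t - r) - f t) * (r * (3 * (p t r * q t r))) := by
  unfold radFlux
  rw [hV]
  field_simp
  ring

theorem abs_multiplier_flux_le {r P R V a b c d e : ℝ} (hr : 0 < r) (ha : |a| ≤ r) (hb : |b| ≤ r)
    (hc : |c| ≤ 2 * r) (hd : |d| ≤ 2) (he : |e| ≤ r) :
    |a * (r * (P - R) ^ 2) - b * (r * (P + R) ^ 2) + c * (r * (V * R - V ^ 2 / 2))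
      + d * (r ^ 2 * (V ^ 2 / 2)) + e * (r * (3 * (P * R)))| ≤
      r ^ 2 * (5 * (P ^ 2 + R ^ 2 + V ^ 2)) := by
  have m1 : |a * (r * (P - R) ^ 2)| ≤ r * (r * (P - R) ^ 2) := by
    rw [abs_mul, abs_of_nonneg (by positivity : 0 ≤ r * (P - R) ^ 2)]
    exact mul_le_mul_of_nonneg_right ha (by positivity)
  have m2 : |b * (r * (P + R) ^ 2)| ≤ r * (r * (P + R) ^ 2) := by
    rw [abs_mul, abs_of_nonneg (by positivity : 0 ≤ r * (P + R) ^ 2)]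
    exact mul_le_mul_of_nonneg_right hb (by positivity)
  have m3 : |c * (r * (V * R - V ^ 2 / 2))| ≤ 2 * r * (r * (V ^ 2 + R ^ 2 / 2)) := by
    rw [abs_mul, abs_mul, abs_of_pos hr]
    have : |V * R - V ^ 2 / 2| ≤ V ^ 2 + R ^ 2 / 2 := by
      rw [abs_le]; constructor <;> nlinarith [sq_nonneg (V + R), sq_nonneg (V - R)]
    exact mul_le_mul hc (mul_le_mul_of_nonneg_left this hr.le) (by positivity) (by positivity)
  have m4 : |d * (r ^ 2 * (V ^ 2 / 2))| ≤ 2 * (r ^ 2 * (V ^ 2 / 2)) := by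
    rw [abs_mul, abs_of_nonneg (by positivity : 0 ≤ r ^ 2 * (V ^ 2 / 2))]
    exact mul_le_mul_of_nonneg_right hd (by positivity)
  have m5 : |e * (r * (3 * (P * R)))| ≤ r * (r * (3 * ((P ^ 2 + R ^ 2) / 2))) := by
    rw [abs_mul, abs_mul, abs_of_pos hr]
    have : |3 * (P * R)| ≤ 3 * ((P ^ 2 + R ^ 2) / 2) := by
      rw [abs_le]; constructor <;> nlinarith [sq_nonneg (P + R), sq_nonneg (P - R)]
    exact mul_le_mul he (mul_le_mul_of_nonneg_left this hr.le) (by positivity) hr.le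
  have hP : 0 ≤ r ^ 2 * P ^ 2 := by positivity
  have hR : 0 ≤ r ^ 2 * R ^ 2 := by positivity
  have hVV : 0 ≤ r ^ 2 * V ^ 2 := by positivity
  rw [abs_le] at *
  constructor <;> linarith [m1.1, m1.2, m2.1, m2.2, m3.1, m3.2, m4.1, m4.2, m5.1, m5.2]

theorem abs_radFlux_le (hw : IsWeight f f₁ f₂ g g₁) {t r : ℝ} (ht : 0 ≤ t) (hr : 0 < r) :
    |radFlux f f₁ g u p q t r| ≤ r * (5 * linDen u p q t r) := by
  have ha := hw.abs_sub_le (t - r) t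
  have hb := hw.abs_sub_le (t + r) t
  have hc := hw.abs_sub_le (t - r) (t + r)
  have he : |g (t - r) - f t| ≤ r := by
    rw [hw.pos_eq]
    refine (hw.abs_sub_le _ _).trans ?_
    rw [abs_le]
    refine ⟨by linarith [le_max_left (t - r) 0], ?_⟩
    have := max_le (by linarith : t - r ≤ t + r) (by linarith : 0 ≤ t + r)
    linarith
  rw [show t - r - t = -r by ring, abs_neg, abs_of_pos hr] at ha
  rw [show t + r - t = r by ring, abs_of_pos hr] at hb
  rw [show t - r - (t + r) = -(2 * r) by ring, abs_neg, abs_of_pos (by linarith : 0 < 2 * r)] at hc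
  have hd : |f₁ (t + r) + f₁ (t - r)| ≤ 2 :=
    (abs_add_le _ _).trans (by linarith [hw.abs_deriv_le (t + r), hw.abs_deriv_le (t - r)])
  have hV : u t r = u t r / r * r := by field_simp
  have el : r * (5 * linDen u p q t r) =
      r ^ 2 * (5 * ((p t r) ^ 2 + (q t r) ^ 2 + (u t r / r) ^ 2)) := by
    unfold linDen
    rw [div_pow]
    ring
  rw [radFlux_eq hr hV, el]
  exact abs_multiplier_flux_le hr ha hb hc hd he

/-- Radial derivative of `½ u² (2 g(t - r) - f(t + r) - f(t - r))`. -/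
def radCorr' (f f₁ g g₁ : ℝ → ℝ) (u q : ℝ → ℝ → ℝ) (t r : ℝ) : ℝ :=
  u t r * q t r * (2 * g (t - r) - f (t + r) - f (t - r))
    + 1 / 2 * (u t r) ^ 2 * (-(2 * g₁ (t - r)) - f₁ (t + r) + f₁ (t - r))

theorem hasDerivAt_radCorr (hw : IsWeight f f₁ f₂ g g₁) (h : IsLinSol u p q pp pq qq) (t : ℝ)
    {r : ℝ} (hr : 0 < r) :
    HasDerivAt (fun r => 1 / 2 * (u t r) ^ 2 * (2 * g (t - r) - f (t + r) - f (t - r)))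
      (radCorr' f f₁ g g₁ u q t r) r := by
  have hu := h.jet.dr t (mem_univ t) r hr
  have fa := (hw.hasDerivAt (t + r)).comp_const_add t r
  have fb := (hw.hasDerivAt (t - r)).comp_const_sub t r
  have gb := (hw.hasDerivAt_pos (t - r)).comp_const_sub t r
  refine (((hu.pow 2).const_mul (1 / 2)).mul (((gb.const_mul 2).sub fa).sub fb)).congr_deriv ?_
  unfold radCorr'
  simp only [Pi.sub_apply, Pi.pow_apply]
  push_cast
  ring

theorem continuousOn_radCorr' (hw : IsWeight f f₁ f₂ g g₁) (h : IsLinSol u p q pp pq qq) (t : ℝ) :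
    ContinuousOn (radCorr' f f₁ g g₁ u q t) (Ioi 0) := by
  have h1 := h.jet.slice_u (mem_univ t)
  have h3 := h.jet.slice_q (mem_univ t)
  have h4 := hw.continuous_self
  have h5 := hw.continuous_deriv
  have h6 := hw.continuous_posPart
  have h8 := hw.continuous_pos
  unfold radCorr'
  fun_prop

theorem abs_radCorr_le (hw : IsWeight f f₁ f₂ g g₁) (t : ℝ) {r : ℝ} (hr : 0 < r) :
    |1 / 2 * (u t r) ^ 2 * (2 * g (t - r) - f (t + r) - f (t - r))| ≤ r * linDen u p q t r := by
  have h1 : |2 * g (t - r) - f (t + r) - f (t - r)| ≤ 2 := by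
    have := hw.nonneg (t + r)
    have := hw.nonneg (t - r)
    have := hw.le_one (t + r)
    have := hw.le_one (t - r)
    have := hw.pos_nonneg (t - r)
    have := hw.pos_le (t - r)
    rw [abs_le]; constructor <;> linarith
  rw [abs_mul, abs_of_nonneg (by positivity : 0 ≤ 1 / 2 * (u t r) ^ 2)]
  have e : r * linDen u p q t r = (r * p t r) ^ 2 + (r * q t r) ^ 2 + (u t r) ^ 2 := by
    unfold linDen; field_simp
  rw [e]
  nlinarith [sq_nonneg (r * p t r), sq_nonneg (r * q t r),
    mul_le_mul_of_nonneg_left h1 (by positivity : 0 ≤ 1 / 2 * (u t r) ^ 2)]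

theorem le_radDen (hw : IsWeight f f₁ f₂ g g₁) {t r : ℝ} (ht : 0 ≤ t) (hr : 0 < r) :
    1 / 2 * (f (t - r) * linDen u p q t r) + radCorr' f f₁ g g₁ u q t r ≤
      radDen f f₁ g u p q t r + 1 / 2 * f t * linDen u p q t r := by
  have h1 := sub_nonneg.2 (hw.sub_le_add ht hr)
  have h2 := sub_nonneg.2 (hw.pos_le (t - r))
  set P := p t r
  set R := q t r
  set V := u t r / r with hV
  have hu : u t r = V * r := by rw [hV]; field_simp
  have k1 : 0 ≤ (f (t + r) - f (t - r)) * (r * ((P + R) ^ 2 + V ^ 2 + V * (P + R))) :=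
    mul_nonneg h1 (mul_nonneg hr.le (by
      nlinarith [sq_nonneg (2 * V + (P + R)), sq_nonneg (P + R)]))
  have k2 : 0 ≤ (f (t - r) - g (t - r)) *
      (r * (3 / 2 * (P ^ 2 + R ^ 2 + V ^ 2) + 2 * (V * R))) :=
    mul_nonneg h2 (mul_nonneg hr.le (by
      nlinarith [sq_nonneg (V + R), sq_nonneg P, sq_nonneg V, sq_nonneg R]))
  have k3 : 0 ≤ (V * r) ^ 2 * g₁ (t - r) := mul_nonneg (sq_nonneg _) (hw.deriv_pos_nonneg _)
  have e : radDen f f₁ g u p q t r + 1 / 2 * f t * linDen u p q t r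
      - (1 / 2 * (f (t - r) * linDen u p q t r) + radCorr' f f₁ g g₁ u q t r) =
      (f (t + r) - f (t - r)) * (r * ((P + R) ^ 2 + V ^ 2 + V * (P + R))) +
      (f (t - r) - g (t - r)) * (r * (3 / 2 * (P ^ 2 + R ^ 2 + V ^ 2) + 2 * (V * R))) +
      (V * r) ^ 2 * g₁ (t - r) := by
    unfold radDen radCorr' linDen
    rw [hu]
    field_simp
    ring
  linarith

theorem radDen_zero_le (hw : IsWeight f f₁ f₂ g g₁) {r : ℝ} (hr : 0 < r) :
    radDen f f₁ g u p q 0 r ≤ 2 * (f r * linDen u p q 0 r) := by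
  have h1 : g (-r) = 0 := by
    rw [hw.pos_eq, max_eq_right (by linarith), hw.zero]
  have h2 : 0 ≤ (u 0 r) ^ 2 * f₁ r := mul_nonneg (sq_nonneg _) (hw.deriv_nonneg r hr.le)
  have e : radDen f f₁ g u p q 0 r = 2 * (f r * linDen u p q 0 r) - (u 0 r) ^ 2 * f₁ r := by
    unfold radDen linDen
    rw [zero_add, zero_sub, hw.neg, hw.deriv_neg, h1, hw.zero]
    field_simp
    ring
  linarith

theorem IsWeight.integrableOn_mul (hw : IsWeight f f₁ f₂ g g₁) {F : ℝ → ℝ}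
    (hF : IntegrableOn F (Ioi 0)) (t : ℝ) : IntegrableOn (fun r => f (t - r) * F r) (Ioi 0) := by
  refine hF.bdd_mul (c := 1) ?_ (Eventually.of_forall fun r => ?_)
  · have := hw.continuous_self
    exact Continuous.aestronglyMeasurable (by fun_prop)
  · rw [Real.norm_eq_abs, abs_of_nonneg (hw.nonneg _)]
    exact hw.le_one _

/-- Concentration of the energy of a linear solution near the light cone. -/
theorem IsWeight.integral_mul_linDen_le (hw : IsWeight f f₁ f₂ g g₁) (h : IsLinSol u p q pp pq qq)
    {T : ℝ} (hT : 0 ≤ T) :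
    ∫ r in Ioi 0, f (T - r) * linDen u p q T r ≤ 4 * ∫ r in Ioi 0, f r * linDen u p q 0 r := by
  obtain ⟨χ, χ', a, b, hχ, hlim⟩ := exists_logCutoff
  set E := ∫ r in Ioi 0, linDen u p q 0 r with hE
  have hEt : ∀ t, ∫ r in Ioi 0, linDen u p q t r = E := fun t => h.energy_eq t 0
  have hI0 : IntegrableOn (fun r => f r * linDen u p q 0 r) (Ioi 0) := by
    have := hw.integrableOn_mul (h.fin 0) 0
    simpa only [zero_sub, hw.neg] using this
  have hcf := hw.continuous_self
  have hcf₁ := hw.continuous_deriv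
  let z : ℕ → ℝ → ℝ := fun n t => ∫ r in Ioi 0, χ n r * linDen u p q t r
  let y : ℕ → ℝ → ℝ := fun n t => ∫ r in Ioi 0, χ n r * radDen f f₁ g u p q t r
  have hz0 : ∀ n t, 0 ≤ z n t := fun n t => setIntegral_nonneg measurableSet_Ioi fun r hr =>
    mul_nonneg ((hχ n).nonneg r) (linDen_nonneg u p q t hr)
  have hzE : ∀ n t, z n t ≤ E := fun n t => by
    rw [← hEt t]
    exact setIntegral_mono_on ((hχ n).integrableOn_mul (h.continuousOn_linDen t)) (h.fin t)
      measurableSet_Ioi fun r hr => mul_le_of_le_one_left (linDen_nonneg u p q t hr)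
        ((hχ n).le_one r)
  have hzc : ∀ n, Continuous (z n) := fun n =>
    continuous_iff_continuousAt.2 fun t => (h.hasDerivAt_linDen (hχ n) t).continuousAt
  have hz : ∀ t, Tendsto (fun n => z n t) atTop (nhds E) := fun t => by
    rw [← hEt t]
    exact tendsto_integral_cutoff hχ hlim (h.fin t)
  have hy : ∀ n t, HasDerivAt (y n)
      (∫ r in Ioi 0, χ n r * radDen' f f₁ f₂ g g₁ u p q pp pq t r) t := fun n t =>
    (hχ n).hasDerivAt_integral (I := univ) isOpen_univ
      (D := fun t r => radDen f f₁ g u p q t r)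
      (fun t _ r hr => hasDerivAt_radDen hw h t hr) (fun t _ => continuousOn_radDen hw h t)
      (continuousOn_radDen' hw h) (mem_univ t)
  have hy' : ∀ n t, 0 ≤ t → ∫ r in Ioi 0, χ n r * radDen' f f₁ f₂ g g₁ u p q pp pq t r ≤
      -(1 / 2 * (f₁ t * z n t)) + 1 / ((n : ℝ) + 1) * (5 * E) := by
    intro n t ht
    have hflux := (hχ n).abs_integral_mul_deriv_le
      (fun r hr => hasDerivAt_radFlux hw h t hr) (continuousOn_radFlux' hw h t)
      ((h.fin t).const_mul 5) (fun r hr => abs_radFlux_le hw ht hr)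
    rw [integral_const_mul, hEt] at hflux
    have i1 : IntegrableOn (fun r => χ n r * radDen' f f₁ f₂ g g₁ u p q pp pq t r) (Ioi 0) :=
      (hχ n).integrableOn_mul (continuousOn_slice (F := radDen' f f₁ f₂ g g₁ u p q pp pq)
        (continuousOn_radDen' hw h) (mem_univ t))
    have i2 := (hχ n).integrableOn_mul (continuousOn_radFlux' hw h t)
    have i3 := (hχ n).integrableOn_mul (h.continuousOn_linDen t)
    have hle : (∫ r in Ioi 0, χ n r * radDen' f f₁ f₂ g g₁ u p q pp pq t r) +
        ∫ r in Ioi 0, χ n r * radFlux' f f₁ f₂ g g₁ u p q pq qq t r ≤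
        ∫ r in Ioi 0, -(1 / 2 * f₁ t) * (χ n r * linDen u p q t r) := by
      rw [← integral_add i1 i2]
      refine setIntegral_mono_on (i1.add i2) (i3.const_mul _) measurableSet_Ioi fun r hr => ?_
      have := mul_le_mul_of_nonneg_left (radDen'_add_radFlux'_le hw h ht hr) ((hχ n).nonneg r)
      linarith
    rw [integral_const_mul] at hle
    have := (abs_le.1 hflux).1
    simp only [z]
    linarith
  have hint : ∀ n, y n T - y n 0 ≤
      ∫ t in (0 : ℝ)..T, (-(1 / 2 * (f₁ t * z n t)) + 1 / ((n : ℝ) + 1) * (5 * E)) := by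
    intro n
    refine intervalIntegral.sub_le_integral_of_hasDeriv_right_of_le hT
      (fun t _ => (hy n t).continuousAt.continuousWithinAt)
      (fun t _ => (hy n t).hasDerivWithinAt) ?_ (fun t ht => hy' n t ht.1.le)
    have := hzc n
    exact Continuous.integrableOn_Icc (by fun_prop)
  have hi : ∀ n, IntervalIntegrable (fun t => f₁ t * z n t) volume 0 T := fun n =>
    (hcf₁.mul (hzc n)).intervalIntegrable 0 T
  have hy0 : ∀ n, y n 0 ≤ 2 * ∫ r in Ioi 0, f r * linDen u p q 0 r := by
    intro n
    rw [← integral_const_mul]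
    refine setIntegral_mono_on ((hχ n).integrableOn_mul (continuousOn_radDen hw h 0))
      (hI0.const_mul 2) measurableSet_Ioi fun r hr => ?_
    refine (mul_le_mul_of_nonneg_left (radDen_zero_le hw hr) ((hχ n).nonneg r)).trans ?_
    exact mul_le_of_le_one_left (mul_nonneg zero_le_two
      (mul_nonneg (hw.nonneg r) (linDen_nonneg u p q 0 hr))) ((hχ n).le_one r)
  have hcT : ContinuousOn (fun r => f (T - r) * linDen u p q T r) (Ioi 0) := by
    have := h.continuousOn_linDen T
    fun_prop
  have hyT : ∀ n, 1 / 2 * (∫ r in Ioi 0, χ n r * (f (T - r) * linDen u p q T r))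
      - 1 / ((n : ℝ) + 1) * E ≤ y n T + 1 / 2 * (f T * z n T) := by
    intro n
    have hflux := (hχ n).abs_integral_mul_deriv_le
      (fun r hr => hasDerivAt_radCorr hw h T hr) (continuousOn_radCorr' hw h T)
      (h.fin T) (fun r hr => abs_radCorr_le hw T hr)
    rw [hEt] at hflux
    have i1 := ((hχ n).integrableOn_mul hcT).const_mul (1 / 2)
    have i2 := (hχ n).integrableOn_mul (continuousOn_radCorr' hw h T)
    have i3 := (hχ n).integrableOn_mul (continuousOn_radDen hw h T)
    have i4 := ((hχ n).integrableOn_mul (h.continuousOn_linDen T)).const_mul (1 / 2 * f T)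
    have hle : (∫ r in Ioi 0, 1 / 2 * (χ n r * (f (T - r) * linDen u p q T r))) +
        ∫ r in Ioi 0, χ n r * radCorr' f f₁ g g₁ u q T r ≤
        (∫ r in Ioi 0, χ n r * radDen f f₁ g u p q T r) +
        ∫ r in Ioi 0, (1 / 2 * f T) * (χ n r * linDen u p q T r) := by
      rw [← integral_add i1 i2, ← integral_add i3 i4]
      refine setIntegral_mono_on (i1.add i2) (i3.add i4) measurableSet_Ioi fun r hr => ?_
      have := mul_le_mul_of_nonneg_left (le_radDen hw (u := u) (p := p) (q := q) hT hr)
        ((hχ n).nonneg r)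
      linarith
    rw [integral_const_mul, integral_const_mul] at hle
    have := (abs_le.1 hflux).1
    simp only [z, y]
    linarith
  have hmain : ∀ n, 1 / 2 * (∫ r in Ioi 0, χ n r * (f (T - r) * linDen u p q T r)) ≤
      2 * (∫ r in Ioi 0, f r * linDen u p q 0 r) + 1 / 2 * (f T * z n T)
        - 1 / 2 * (∫ t in (0 : ℝ)..T, f₁ t * z n t) + 1 / ((n : ℝ) + 1) * (5 * E * T + E) := by
    intro n
    have h1 := hint n
    have hi' : IntervalIntegrable (fun t => -(1 / 2 * (f₁ t * z n t))) volume 0 T :=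
      ((hi n).const_mul _).neg
    rw [intervalIntegral.integral_add hi' intervalIntegrable_const,
      intervalIntegral.integral_neg, intervalIntegral.integral_const_mul,
      intervalIntegral.integral_const, smul_eq_mul, sub_zero] at h1
    linarith [hy0 n, hyT n]
  have hlimz : Tendsto (fun n => ∫ t in (0 : ℝ)..T, f₁ t * z n t) atTop
      (nhds (∫ t in (0 : ℝ)..T, f₁ t * E)) := by
    refine intervalIntegral.tendsto_integral_filter_of_dominated_convergence (fun _ => E)
      (Eventually.of_forall fun n => (hcf₁.mul (hzc n)).aestronglyMeasurable)
      (Eventually.of_forall fun n => Eventually.of_forall fun t _ => ?_) intervalIntegrable_const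
      (Eventually.of_forall fun t _ => (hz t).const_mul _)
    rw [norm_mul, Real.norm_eq_abs, Real.norm_eq_abs, abs_of_nonneg (hz0 n t)]
    exact (mul_le_of_le_one_left (hz0 n t) (hw.abs_deriv_le t)).trans (hzE n t)
  have hftc : ∫ t in (0 : ℝ)..T, f₁ t * E = f T * E := by
    rw [intervalIntegral.integral_mul_const, intervalIntegral.integral_eq_sub_of_hasDerivAt
      (fun t _ => hw.hasDerivAt t) (hcf₁.intervalIntegrable 0 T), hw.zero, sub_zero]
  have hL := (tendsto_integral_cutoff hχ hlim (hw.integrableOn_mul (h.fin T) T)).const_mul (1 / 2)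
  have hR := (((((hz T).const_mul (f T)).const_mul (1 / 2)).const_add
    (2 * ∫ r in Ioi 0, f r * linDen u p q 0 r)).sub (hlimz.const_mul (1 / 2))).add
    (tendsto_one_div_add_atTop_nhds_zero_nat.mul_const (5 * E * T + E))
  have := le_of_tendsto_of_tendsto' hL hR hmain
  rw [hftc] at this
  linarith

end

theorem tendsto_ratWeight_atTop (s : ℝ) :
    Tendsto (fun n : ℕ => ratWeight ((n : ℝ) + 1) s) atTop (nhds 0) := by
  unfold ratWeight
  refine Tendsto.const_div_atTop ?_ _
  exact tendsto_atTop_add_const_right _ _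
    (tendsto_atTop_add_const_right _ _ tendsto_natCast_atTop_atTop)

theorem half_le_ratWeight {k s : ℝ} (hk : 0 < k) (hs : k ≤ s ^ 2) : 1 / 2 ≤ ratWeight k s := by
  unfold ratWeight
  rw [div_le_div_iff₀ (by norm_num) (by positivity)]
  linarith

/-- The energy of a linear solution concentrates near the light cone, uniformly in time. -/
theorem IsLinSol.exists_integral_linDen_le {u p q pp pq qq : ℝ → ℝ → ℝ}
    (h : IsLinSol u p q pp pq qq) {ε : ℝ} (hε : 0 < ε) :
    ∃ A₀ > 0, ∀ A, A₀ ≤ A → ∀ T, 0 ≤ T →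
      ∫ r in Ioi 0 ∩ {r | A ≤ |r - T|}, linDen u p q T r ≤ ε := by
  have hlim : Tendsto (fun n : ℕ => ∫ r in Ioi 0, ratWeight ((n : ℝ) + 1) r * linDen u p q 0 r)
      atTop (nhds (∫ r in Ioi (0 : ℝ), 0)) := by
    refine tendsto_integral_of_dominated_convergence (linDen u p q 0) (fun n => ?_) (h.fin 0)
      (fun n => ?_) ?_
    · have hw := isWeight_ratWeight (k := (n : ℝ) + 1) (by linarith [n.cast_nonneg (α := ℝ)])
      have := (hw.integrableOn_mul (h.fin 0) 0).aestronglyMeasurable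
      simpa only [zero_sub, hw.neg] using this
    · have hw := isWeight_ratWeight (k := (n : ℝ) + 1) (by linarith [n.cast_nonneg (α := ℝ)])
      refine (ae_restrict_iff' measurableSet_Ioi).2 (Eventually.of_forall fun r hr => ?_)
      have := linDen_nonneg u p q 0 hr
      rw [Real.norm_eq_abs, abs_of_nonneg (mul_nonneg (hw.nonneg r) this)]
      exact mul_le_of_le_one_left this (hw.le_one r)
    · refine Eventually.of_forall fun r => ?_
      simpa using (tendsto_ratWeight_atTop r).mul_const (linDen u p q 0 r)
  rw [integral_zero] at hlim
  obtain ⟨n, hn⟩ := (hlim.eventually (gt_mem_nhds (by positivity : 0 < ε / 8))).exists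
  have hk : 1 ≤ (n : ℝ) + 1 := by linarith [n.cast_nonneg (α := ℝ)]
  have hw := isWeight_ratWeight hk
  refine ⟨(n : ℝ) + 1, by linarith, fun A hA T hT => ?_⟩
  have hi : IntegrableOn (fun r => 2 * (ratWeight ((n : ℝ) + 1) (T - r) * linDen u p q T r))
      (Ioi 0) := (hw.integrableOn_mul (h.fin T) T).const_mul 2
  have hS : MeasurableSet (Ioi 0 ∩ {r : ℝ | A ≤ |r - T|}) :=
    measurableSet_Ioi.inter (measurableSet_le measurable_const (by fun_prop))
  have h1 : ∫ r in Ioi 0 ∩ {r | A ≤ |r - T|}, linDen u p q T r ≤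
      ∫ r in Ioi 0 ∩ {r | A ≤ |r - T|}, 2 * (ratWeight ((n : ℝ) + 1) (T - r) * linDen u p q T r) := by
    refine setIntegral_mono_on ((h.fin T).mono_set inter_subset_left)
      (hi.mono_set inter_subset_left) hS fun r hr => ?_
    have h0 := linDen_nonneg u p q T hr.1
    have h2 : A ≤ |r - T| := hr.2
    have h3 : (n : ℝ) + 1 ≤ (T - r) ^ 2 := by
      rw [← sq_abs, abs_sub_comm]
      nlinarith
    have := mul_le_mul_of_nonneg_right (half_le_ratWeight (by linarith) h3) h0
    linarith
  have h2 : ∫ r in Ioi 0 ∩ {r | A ≤ |r - T|},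
      2 * (ratWeight ((n : ℝ) + 1) (T - r) * linDen u p q T r) ≤
      ∫ r in Ioi 0, 2 * (ratWeight ((n : ℝ) + 1) (T - r) * linDen u p q T r) := by
    refine setIntegral_mono_set hi ?_ (Eventually.of_forall inter_subset_left)
    exact (ae_restrict_iff' measurableSet_Ioi).2 (Eventually.of_forall fun r hr =>
      mul_nonneg zero_le_two (mul_nonneg (hw.nonneg _) (linDen_nonneg u p q T hr)))
  simp only [integral_const_mul] at h1 h2
  linarith [hw.integral_mul_linDen_le h hT]

theorem eDen_nonneg (ψ : ℝ → ℝ → ℝ) (t : ℝ) {r : ℝ} (hr : 0 < r) : 0 ≤ eDen ψ t r := by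
  unfold eDen; positivity

theorem abs_momentum_le_eDen (ψ : ℝ → ℝ → ℝ) (t : ℝ) {r : ℝ} (hr : 0 < r) :
    |2 * r * (pT ψ t r * pR ψ t r)| ≤ eDen ψ t r := by
  have h0 : 0 ≤ (sin (ψ t r)) ^ 2 / r ^ 2 * r := by positivity
  unfold eDen
  rw [abs_le]
  constructor <;> nlinarith [mul_nonneg hr.le (sq_nonneg (pT ψ t r + pR ψ t r)),
    mul_nonneg hr.le (sq_nonneg (pT ψ t r - pR ψ t r))]

/-- Time derivative of the energy density, written as a divergence. -/
def eDen' (ψ : ℝ → ℝ → ℝ) (t r : ℝ) : ℝ :=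
  2 * (pT ψ t r * pR ψ t r)
    + 2 * r * (pR (pT ψ) t r * pR ψ t r + pT ψ t r * pR (pR ψ) t r)

namespace IsWaveMap

variable {φ : ℝ → ℝ → ℝ}

theorem isJet (h : IsWaveMap φ) :
    IsJet (Ioi 0) φ (pT φ) (pR φ) (pT (pT φ)) (pR (pT φ)) (pR (pR φ)) :=
  isJet_of_smooth isOpen_Ioi (h.1.mono (prod_mono Ioi_subset_Ici_self Subset.rfl))

theorem hasDerivAt_eDen (h : IsWaveMap φ) {t r : ℝ} (ht : 0 < t) (hr : 0 < r) :
    HasDerivAt (fun t => eDen φ t r) (eDen' φ t r) t := by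
  have hu := h.isJet.dt t ht r hr
  have hp := h.isJet.dtt t ht r hr
  have hq := h.isJet.drt t ht r hr
  have he : pT (pT φ) t r - pR (pR φ) t r - 1 / r * pR φ t r
      + sin (2 * φ t r) / (2 * r ^ 2) = 0 := h.2 t r ht.le hr
  have he' : pT (pT φ) t r = pR (pR φ) t r + 1 / r * pR φ t r
      - sin (2 * φ t r) / (2 * r ^ 2) := by linarith
  refine ((((hp.pow 2).add (hq.pow 2)).add ((hu.sin.pow 2).div_const (r ^ 2))).mul_const
    r).congr_deriv ?_
  rw [he', sin_two_mul]
  unfold eDen'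
  field_simp
  push_cast
  ring

theorem hasDerivAt_momentum (h : IsWaveMap φ) {t r : ℝ} (ht : 0 < t) (hr : 0 < r) :
    HasDerivAt (fun r => 2 * r * (pT φ t r * pR φ t r)) (eDen' φ t r) r := by
  have hp := h.isJet.dtr t ht r hr
  have hq := h.isJet.drr t ht r hr
  refine (((hasDerivAt_id r).const_mul 2).mul (hp.mul hq)).congr_deriv ?_
  unfold eDen'
  simp only [id, Pi.mul_apply]
  ring

theorem continuousOn_eDen (h : IsWaveMap φ) :
    ContinuousOn (fun x : ℝ × ℝ => eDen φ x.1 x.2) (Ioi 0 ×ˢ Ioi 0) := by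
  have h1 := h.isJet.cu
  have h2 := h.isJet.cp
  have h3 := h.isJet.cq
  unfold eDen
  refine ((((h2.pow 2).add (h3.pow 2)).add ?_)).mul (by fun_prop)
  exact ((continuous_sin.comp_continuousOn h1).pow 2).div (by fun_prop)
    fun x hx => pow_ne_zero 2 (ne_of_gt hx.2)

theorem continuousOn_eDen' (h : IsWaveMap φ) :
    ContinuousOn (fun x : ℝ × ℝ => eDen' φ x.1 x.2) (Ioi 0 ×ˢ Ioi 0) := by
  have h2 := h.isJet.cp
  have h3 := h.isJet.cq
  have h4 := h.isJet.cpq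
  have h5 := h.isJet.cqq
  unfold eDen'
  fun_prop

end IsWaveMap

theorem ratWeight_nonneg {k : ℝ} (hk : 0 < k) (s : ℝ) : 0 ≤ ratWeight k s := by
  unfold ratWeight; positivity

theorem ratWeight_le_one {k : ℝ} (hk : 0 < k) (s : ℝ) : ratWeight k s ≤ 1 := by
  unfold ratWeight
  rw [div_le_one (by positivity)]
  linarith

theorem tendsto_ratWeight_max (s : ℝ) :
    Tendsto (fun n : ℕ => ratWeight (1 / ((n : ℝ) + 1)) (max s 0)) atTop
      (nhds ((Ioi 0).indicator 1 s)) := by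
  rcases le_or_gt s 0 with h | h
  · have : s ∉ Ioi (0 : ℝ) := not_lt.2 h
    simp [this, max_eq_right h, ratWeight]
  · have hs : s ∈ Ioi (0 : ℝ) := h
    rw [max_eq_left h.le, indicator_of_mem hs, Pi.one_apply]
    have h1 := ((tendsto_one_div_add_atTop_nhds_zero_nat (𝕜 := ℝ)).add_const (s ^ 2))
    have h2 := (tendsto_const_nhds (x := s ^ 2)).div h1 (by positivity)
    rw [zero_add, div_self (by positivity)] at h2
    exact h2

section Exterior

variable {φ : ℝ → ℝ → ℝ} {k A : ℝ}

theorem integrableOn_ratWeight_mul (hk : 0 < k) (c : ℝ) {F : ℝ → ℝ} (hF : IntegrableOn F (Ioi 0)) :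
    IntegrableOn (fun r => ratWeight k (max (r + c) 0) * F r) (Ioi 0) := by
  refine hF.bdd_mul (c := 1) ?_ (Eventually.of_forall fun r => ?_)
  · have : Continuous (fun s => ratWeight k (max s 0)) := continuous_iff_continuousAt.2 fun s =>
      (hasDerivAt_ratWeight_max hk s).continuousAt
    exact Continuous.aestronglyMeasurable (this.comp (continuous_add_const c))
  · rw [Real.norm_eq_abs, abs_of_nonneg (ratWeight_nonneg hk _)]
    exact ratWeight_le_one hk _

theorem integral_ratWeight_mul_eDen_antitone (h : IsWaveMap φ) (hfe : FiniteEnergy φ)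
    (hcons : EnergyConserved φ) (hk : 0 < k) (hA : 0 ≤ A) {t₁ t₂ : ℝ} (h₁ : A + 1 ≤ t₁)
    (h₁₂ : t₁ ≤ t₂) :
    ∫ r in Ioi 0, ratWeight k (max (r + (A - t₂)) 0) * eDen φ t₂ r ≤
      ∫ r in Ioi 0, ratWeight k (max (r + (A - t₁)) 0) * eDen φ t₁ r := by
  obtain ⟨χ, χ', a, b, hχ, hlim⟩ := exists_logCutoff
  have hg := hasDerivAt_ratWeight_max hk
  have hgc : Continuous (fun s => ratWeight k (max s 0)) :=
    continuous_iff_continuousAt.2 fun s => (hg s).continuousAt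
  have hgc' : Continuous (fun s => ratWeight' k (max s 0)) :=
    (continuous_ratWeight' hk).comp (by fun_prop)
  have ce := h.continuousOn_eDen
  have ce' := h.continuousOn_eDen'
  let D : ℝ → ℝ → ℝ := fun t r => ratWeight k (max (r + (A - t)) 0) * eDen φ t r
  let D' : ℝ → ℝ → ℝ := fun t r => -ratWeight' k (max (r + (A - t)) 0) * eDen φ t r
    + ratWeight k (max (r + (A - t)) 0) * eDen' φ t r
  let F : ℝ → ℝ → ℝ := fun t r => ratWeight' k (max (r + (A - t)) 0) *
    (2 * r * (pT φ t r * pR φ t r)) + ratWeight k (max (r + (A - t)) 0) * eDen' φ t r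
  have hD : ∀ t ∈ Ioi (0 : ℝ), ∀ r, 0 < r → HasDerivAt (fun s => D s r) (D' t r) t := by
    intro t ht r hr
    have h1 : HasDerivAt (fun t => r + (A - t)) (-1) t :=
      ((hasDerivAt_id t).const_sub A).const_add r
    refine (((hg (r + (A - t))).comp t h1).mul (h.hasDerivAt_eDen ht hr)).congr_deriv ?_
    simp only [D', Function.comp]
    ring
  have hDc : ∀ t ∈ Ioi (0 : ℝ), ContinuousOn (D t) (Ioi 0) := by
    intro t ht
    have := continuousOn_slice (F := eDen φ) ce ht
    have h2 : Continuous fun r : ℝ => ratWeight k (max (r + (A - t)) 0) :=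
      hgc.comp (continuous_add_const (A - t))
    exact h2.continuousOn.mul this
  have hcx : Continuous fun x : ℝ × ℝ => x.2 + (A - x.1) := by fun_prop
  have hD'c : ContinuousOn (fun x : ℝ × ℝ => D' x.1 x.2) (Ioi 0 ×ˢ Ioi 0) :=
    (((hgc'.comp hcx).neg.continuousOn).mul ce).add ((hgc.comp hcx).continuousOn.mul ce')
  have hFd : ∀ t ∈ Ioi (0 : ℝ), ∀ r, 0 < r → HasDerivAt (fun r =>
      ratWeight k (max (r + (A - t)) 0) * (2 * r * (pT φ t r * pR φ t r))) (F t r) r := by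
    intro t ht r hr
    exact ((hg (r + (A - t))).comp_add_const r (A - t)).mul (h.hasDerivAt_momentum ht hr)
  have hFc : ContinuousOn (fun x : ℝ × ℝ => F x.1 x.2) (Ioi 0 ×ˢ Ioi 0) := by
    have h2 := h.isJet.cp
    have h3 := h.isJet.cq
    refine (((hgc'.comp hcx).continuousOn).mul ?_).add ((hgc.comp hcx).continuousOn.mul ce')
    fun_prop
  have hle : ∀ t r, 0 < r → D' t r ≤ F t r := by
    intro t r hr
    have h1 := (abs_le.1 (abs_momentum_le_eDen φ t hr)).1
    have h2 := mul_nonneg (ratWeight'_nonneg hk (le_max_right (r + (A - t)) 0))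
      (by linarith : 0 ≤ eDen φ t r + 2 * r * (pT φ t r * pR φ t r))
    simp only [D', F]
    linarith
  have hbd : ∀ t, A + 1 ≤ t → ∀ r, 0 < r →
      |ratWeight k (max (r + (A - t)) 0) * (2 * r * (pT φ t r * pR φ t r))| ≤ r * eDen φ t r := by
    intro t ht r hr
    have he := eDen_nonneg φ t hr
    rcases le_or_gt r 1 with h1 | h1
    · rw [max_eq_right (by linarith)]
      simp only [ratWeight, ne_eq, OfNat.ofNat_ne_zero, not_false_eq_true, zero_pow, zero_div,
        zero_mul, abs_zero]
      positivity
    · rw [abs_mul, abs_of_nonneg (ratWeight_nonneg hk _)]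
      calc _ ≤ 1 * eDen φ t r := mul_le_mul (ratWeight_le_one hk _) (abs_momentum_le_eDen φ t hr)
            (abs_nonneg _) zero_le_one
        _ ≤ _ := mul_le_mul_of_nonneg_right h1.le he
  have hstep : ∀ n, (∫ r in Ioi 0, χ n r * D t₂ r) ≤
      (∫ r in Ioi 0, χ n r * D t₁ r) + 1 / ((n : ℝ) + 1) * totE φ 0 * (t₂ - t₁) := by
    intro n
    have hd : ∀ t ∈ Icc t₁ t₂, HasDerivAt (fun t => ∫ r in Ioi 0, χ n r * D t r)
        (∫ r in Ioi 0, χ n r * D' t r) t := fun t ht =>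
      (hχ n).hasDerivAt_integral isOpen_Ioi hD hDc hD'c
        (show (0 : ℝ) < t by linarith [ht.1])
    have hmv := (convex_Icc t₁ t₂).image_sub_le_mul_sub_of_deriv_le
      (f := fun t => ∫ r in Ioi 0, χ n r * D t r) (C := 1 / ((n : ℝ) + 1) * totE φ 0)
      (fun t ht => (hd t ht).continuousAt.continuousWithinAt)
      (fun t ht => (hd t (interior_subset ht)).differentiableAt.differentiableWithinAt)
      (fun t ht => ?_) t₁ (left_mem_Icc.2 h₁₂) t₂ (right_mem_Icc.2 h₁₂) h₁₂
    · linarith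
    have ht' := interior_subset ht
    have ht0 : t ∈ Ioi (0 : ℝ) := show (0 : ℝ) < t by linarith [ht'.1]
    rw [(hd t ht').deriv]
    have hflux := (hχ n).abs_integral_mul_deriv_le (hFd t ht0)
      (continuousOn_slice (F := F) hFc ht0) (hfe t ht0.le) (hbd t (by linarith [ht'.1]))
    have hE : ∫ r in Ioi 0, eDen φ t r = totE φ 0 := hcons t ht0.le
    rw [hE] at hflux
    refine le_trans ?_ ((le_abs_self _).trans hflux)
    exact setIntegral_mono_on ((hχ n).integrableOn_mul (continuousOn_slice (F := D') hD'c ht0))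
      ((hχ n).integrableOn_mul (continuousOn_slice (F := F) hFc ht0)) measurableSet_Ioi
      fun r hr => mul_le_mul_of_nonneg_left (hle t r hr) ((hχ n).nonneg r)
  have hL := tendsto_integral_cutoff hχ hlim
    (integrableOn_ratWeight_mul hk (A - t₂) (hfe t₂ (by linarith)))
  have hR := (tendsto_integral_cutoff hχ hlim
    (integrableOn_ratWeight_mul hk (A - t₁) (hfe t₁ (by linarith)))).add
    ((tendsto_one_div_add_atTop_nhds_zero_nat.mul_const (totE φ 0)).mul_const (t₂ - t₁))
  have := le_of_tendsto_of_tendsto' hL hR hstep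
  linarith

theorem tendsto_integral_ratWeight_mul {F : ℝ → ℝ} (hF : IntegrableOn F (Ioi 0)) (c : ℝ) :
    Tendsto (fun n : ℕ => ∫ r in Ioi 0, ratWeight (1 / ((n : ℝ) + 1)) (max (r + -c) 0) * F r) atTop
      (nhds (∫ r in Ioi 0 ∩ Ici c, F r)) := by
  have e : ∫ r in Ioi 0 ∩ Ici c, F r = ∫ r in Ioi 0, (Ioi 0).indicator 1 (r + -c) * F r := by
    have e1 : (Ioi 0 ∩ Ici c : Set ℝ) =ᵐ[volume] (Ioi 0 ∩ Ioi c : Set ℝ) :=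
      ae_eq_set_inter (ae_eq_refl _) Ioi_ae_eq_Ici.symm
    rw [setIntegral_congr_set e1, ← setIntegral_indicator measurableSet_Ioi]
    congr 1
    ext r
    by_cases hr : c < r
    · have h1 : r ∈ Ioi c := hr
      have h2 : r + -c ∈ Ioi (0 : ℝ) := show 0 < r + -c by linarith
      simp [indicator_of_mem h1, indicator_of_mem h2]
    · have h1 : r ∉ Ioi c := hr
      have h2 : r + -c ∉ Ioi (0 : ℝ) := fun h => hr (by have : 0 < r + -c := h; linarith)
      simp only [indicator_of_notMem h1, indicator_of_notMem h2, zero_mul]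
  rw [e]
  refine tendsto_integral_of_dominated_convergence (fun r => ‖F r‖) (fun n => ?_) hF.norm
    (fun n => ?_) (Eventually.of_forall fun r => (tendsto_ratWeight_max _).mul_const _)
  · exact (integrableOn_ratWeight_mul (by positivity) _ hF).aestronglyMeasurable
  · refine Eventually.of_forall fun r => ?_
    have hk : (0 : ℝ) < 1 / ((n : ℝ) + 1) := by positivity
    rw [norm_mul, Real.norm_eq_abs, abs_of_nonneg (ratWeight_nonneg hk _)]
    exact mul_le_of_le_one_left (norm_nonneg _) (ratWeight_le_one hk _)

/-- The energy outside the light cone `r = t - A` is nonincreasing in time. -/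
theorem exterior_energy_antitone (h : IsWaveMap φ) (hfe : FiniteEnergy φ)
    (hcons : EnergyConserved φ) (hA : 0 ≤ A) :
    AntitoneOn (fun t => ∫ r in Ioi 0 ∩ Ici (t - A), eDen φ t r) (Ici (A + 1)) := by
  intro t₁ h₁ t₂ h₂ h₁₂
  have h₁ : A + 1 ≤ t₁ := h₁
  refine le_of_tendsto_of_tendsto'
    (tendsto_integral_ratWeight_mul (hfe t₂ (by linarith)) (t₂ - A))
    (tendsto_integral_ratWeight_mul (hfe t₁ (by linarith)) (t₁ - A)) fun n => ?_
  simpa only [neg_sub] using integral_ratWeight_mul_eDen_antitone h hfe hcons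
    (k := 1 / ((n : ℝ) + 1)) (by positivity) hA h₁ h₁₂

theorem exterior_energy_nonneg (φ : ℝ → ℝ → ℝ) (t c : ℝ) :
    0 ≤ ∫ r in Ioi 0 ∩ Ici c, eDen φ t r :=
  setIntegral_nonneg (measurableSet_Ioi.inter measurableSet_Ici) fun _ hr => eDen_nonneg φ t hr.1

theorem exists_tendsto_exterior_energy (h : IsWaveMap φ) (hfe : FiniteEnergy φ)
    (hcons : EnergyConserved φ) (hA : 0 ≤ A) :
    ∃ L, Tendsto (fun t => ∫ r in Ioi 0 ∩ Ici (t - A), eDen φ t r) atTop (nhds L) := by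
  have hanti := exterior_energy_antitone h hfe hcons hA
  have hanti' : Antitone fun t : ℝ =>
      ∫ r in Ioi 0 ∩ Ici (max t (A + 1) - A), eDen φ (max t (A + 1)) r := fun x y hxy =>
    hanti (mem_Ici.2 (le_max_right _ _)) (mem_Ici.2 (le_max_right _ _)) (max_le_max_right _ hxy)
  refine ⟨_, (tendsto_atTop_ciInf hanti' ⟨0, ?_⟩).congr' ?_⟩
  · rintro _ ⟨t, rfl⟩
    exact exterior_energy_nonneg φ _ _
  · filter_upwards [eventually_ge_atTop (A + 1)] with t ht
    rw [max_eq_left ht]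

end Exterior

theorem sq_le_four_mul_sin_sq {x : ℝ} (hx : |x| ≤ 1) : x ^ 2 ≤ 4 * (sin x) ^ 2 := by
  have h1 := mul_abs_le_abs_sin (hx.trans (by linarith [pi_gt_three] : (1 : ℝ) ≤ π / 2))
  have h2 : 1 / 2 * |x| ≤ 2 / π * |x| := by
    refine mul_le_mul_of_nonneg_right ?_ (abs_nonneg x)
    rw [div_le_div_iff₀ two_pos pi_pos]
    linarith [pi_le_four]
  rw [← sq_abs x, ← sq_abs (sin x)]
  nlinarith [abs_nonneg x]

theorem IsJet.continuousOn_linDen {I : Set ℝ} {u p q pp pq qq : ℝ → ℝ → ℝ}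
    (h : IsJet I u p q pp pq qq) {t : ℝ} (ht : t ∈ I) : ContinuousOn (linDen u p q t) (Ioi 0) := by
  have h1 := h.slice_u ht
  have h2 := h.slice_p ht
  have h3 := h.slice_q ht
  unfold linDen
  refine (((h2.pow 2).add (h3.pow 2)).add ?_).mul (by fun_prop)
  exact (h1.pow 2).div (by fun_prop) fun x hx => pow_ne_zero 2 (ne_of_gt hx)

theorem linDen_sub_eq {φ ψ : ℝ → ℝ → ℝ} {I : Set ℝ} {p q pp pq qq p' q' pp' pq' qq' : ℝ → ℝ → ℝ}
    (h : IsJet I φ p q pp pq qq) (h' : IsJet univ ψ p' q' pp' pq' qq') {t r : ℝ} (ht : t ∈ I)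
    (hr : 0 < r) :
    hl2Den (fun r => φ t r - ψ t r) (fun r => p t r - p' t r) r =
      linDen (fun t r => φ t r - ψ t r) (fun t r => p t r - p' t r) (fun t r => q t r - q' t r)
        t r := by
  have : deriv (fun r => φ t r - ψ t r) r = q t r - q' t r :=
    ((h.dr t ht r hr).sub (h'.dr t (mem_univ t) r hr)).deriv
  unfold hl2Den linDen
  rw [this]

section Transfer

variable {φ φL : ℝ → ℝ → ℝ}

theorem eDen_le_hl2Den (φ : ℝ → ℝ → ℝ) (t : ℝ) {r : ℝ} (hr : 0 < r) :
    eDen φ t r ≤ hl2Den (φ t) (pT φ t) r := by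
  unfold eDen hl2Den pR
  gcongr ((_ + ?_ / _) * _)
  exact sin_sq_le_sq

theorem hl2Den_nonneg (f g : ℝ → ℝ) {r : ℝ} (hr : 0 < r) : 0 ≤ hl2Den f g r := by
  unfold hl2Den; positivity

theorem IsWaveMap.integrableOn_hl2Den (h : IsWaveMap φ) (hfe : FiniteEnergy φ)
    (hbc : DegreeZeroBC φ) {t : ℝ} (ht : 0 < t) :
    IntegrableOn (hl2Den (φ t) (pT φ t)) (Ioi 0) := by
  have hc : ContinuousOn (hl2Den (φ t) (pT φ t)) (Ioi 0) := h.isJet.continuousOn_linDen ht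
  have hnear : {x : ℝ | |x| ≤ 1} ∈ nhds (0 : ℝ) :=
    mem_of_superset (Metric.closedBall_mem_nhds (0 : ℝ) one_pos) fun x hx => by
      simpa [Real.norm_eq_abs] using hx
  obtain ⟨a, ha, hA⟩ := mem_nhdsGT_iff_exists_Ioo_subset.1 ((hbc t ht.le).1 hnear)
  obtain ⟨b, hB⟩ := mem_atTop_sets.1 ((hbc t ht.le).2 hnear)
  have ha0 : 0 < a := ha
  have hi : IntegrableOn ((Icc a b).indicator (hl2Den (φ t) (pT φ t))) (Ioi 0) :=
    ((integrable_indicator_iff measurableSet_Icc).2 (hc.mono fun r hr =>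
      lt_of_lt_of_le ha0 hr.1).integrableOn_Icc).integrableOn
  refine (((hfe t ht.le).const_mul 4).add hi).mono'
    (hc.aestronglyMeasurable measurableSet_Ioi)
    ((ae_restrict_iff' measurableSet_Ioi).2 (Eventually.of_forall fun r hr => ?_))
  have hr : 0 < r := hr
  rw [Real.norm_eq_abs, abs_of_nonneg (hl2Den_nonneg _ _ hr), Pi.add_apply]
  have he := eDen_nonneg φ t hr
  by_cases hm : r ∈ Icc a b
  · rw [indicator_of_mem hm]
    linarith
  · rw [indicator_of_notMem hm, add_zero]
    have hs : |φ t r| ≤ 1 := by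
      rcases lt_or_ge r a with h1 | h1
      · exact hA ⟨hr, h1⟩
      · exact hB r (not_lt.1 fun h2 => hm ⟨h1, h2.le⟩)
    have h1 : (φ t r) ^ 2 / r ^ 2 ≤ 4 * ((sin (φ t r)) ^ 2 / r ^ 2) := by
      rw [← mul_div_assoc]
      exact div_le_div_of_nonneg_right (sq_le_four_mul_sin_sq hs) (by positivity)
    unfold hl2Den eDen pR
    nlinarith [mul_le_mul_of_nonneg_right h1 hr.le, mul_nonneg hr.le (sq_nonneg (pT φ t r)),
      mul_nonneg hr.le (sq_nonneg (deriv (φ t) r))]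

theorem IsLinearWave.isLinSol (h : IsLinearWave φL) (hfe : LinFiniteEnergy φL) :
    IsLinSol φL (pT φL) (pR φL) (pT (pT φL)) (pR (pT φL)) (pR (pR φL)) where
  jet := isJet_of_smooth isOpen_univ h.1
  eqn t r hr := by
    have : pT (pT φL) t r - pR (pR φL) t r - 1 / r * pR φL t r + φL t r / r ^ 2 = 0 := h.2 t r hr
    rw [div_eq_mul_one_div (pR φL t r) r]
    linarith
  fin := hfe

theorem hl2Sq_le_of_sub (h : IsWaveMap φ) (hfe : FiniteEnergy φ) (hbc : DegreeZeroBC φ)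
    (hlin : IsLinearWave φL) (hlinfe : LinFiniteEnergy φL) {t : ℝ} (ht : 0 < t) {S : Set ℝ}
    (hS : MeasurableSet S) :
    hl2Sq (φ t) (pT φ t) (Ioi 0 ∩ S) ≤
      2 * hl2Sq (fun r => φ t r - φL t r) (fun r => pT φ t r - pT φL t r) (Ioi 0) +
        2 * hl2Sq (φL t) (pT φL t) (Ioi 0 ∩ S) := by
  have hj := h.isJet
  have hjL := (hlin.isLinSol hlinfe).jet
  have h1 := h.integrableOn_hl2Den hfe hbc ht
  have h2 := hlinfe t
  have e := fun r (hr : 0 < r) => linDen_sub_eq hj hjL (mem_Ioi.2 ht) hr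
  have h3 : IntegrableOn (hl2Den (fun r => φ t r - φL t r) (fun r => pT φ t r - pT φL t r))
      (Ioi 0) := by
    have hc : ContinuousOn (hl2Den (fun r => φ t r - φL t r) (fun r => pT φ t r - pT φL t r))
        (Ioi 0) := by
      refine ContinuousOn.congr ?_ fun r hr => e r hr
      have c1 := (hj.slice_u ht).sub (hjL.slice_u (mem_univ t))
      have c2 := (hj.slice_p ht).sub (hjL.slice_p (mem_univ t))
      have c3 := (hj.slice_q ht).sub (hjL.slice_q (mem_univ t))
      unfold linDen
      refine (((c2.pow 2).add (c3.pow 2)).add ?_).mul (by fun_prop)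
      exact (c1.pow 2).div (by fun_prop) fun x hx => pow_ne_zero 2 (ne_of_gt hx)
    refine ((h1.const_mul 2).add (h2.const_mul 2)).mono' (hc.aestronglyMeasurable measurableSet_Ioi)
      ((ae_restrict_iff' measurableSet_Ioi).2 (Eventually.of_forall fun r hr => ?_))
    have hr : 0 < r := hr
    rw [Real.norm_eq_abs, abs_of_nonneg (hl2Den_nonneg _ _ hr), Pi.add_apply, e r hr]
    have k1 := mul_nonneg hr.le (sq_nonneg (pT φ t r + pT φL t r))
    have k2 := mul_nonneg hr.le (sq_nonneg (pR φ t r + pR φL t r))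
    have k3 := mul_nonneg hr.le (sq_nonneg (φ t r / r + φL t r / r))
    simp only [linDen, hl2Den, ← div_pow, sub_div]
    unfold pR at k2 ⊢
    linarith
  have hle : hl2Sq (φ t) (pT φ t) (Ioi 0 ∩ S) ≤ ∫ r in Ioi 0 ∩ S,
      (2 * hl2Den (fun r => φ t r - φL t r) (fun r => pT φ t r - pT φL t r) r +
        2 * hl2Den (φL t) (pT φL t) r) := by
    refine setIntegral_mono_on (h1.mono_set inter_subset_left)
      (((h3.mono_set inter_subset_left).const_mul 2).add
        ((h2.mono_set inter_subset_left).const_mul 2))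
      (measurableSet_Ioi.inter hS) fun r hr => ?_
    have hr : 0 < r := hr.1
    rw [e r hr]
    have k1 := mul_nonneg hr.le (sq_nonneg (pT φ t r - 2 * pT φL t r))
    have k2 := mul_nonneg hr.le (sq_nonneg (pR φ t r - 2 * pR φL t r))
    have k3 := mul_nonneg hr.le (sq_nonneg (φ t r / r - 2 * (φL t r / r)))
    simp only [linDen, hl2Den, ← div_pow, sub_div]
    unfold pR at k2 ⊢
    linarith
  refine hle.trans ?_
  rw [integral_add ((h3.mono_set inter_subset_left).const_mul 2)
    ((h2.mono_set inter_subset_left).const_mul 2), integral_const_mul, integral_const_mul]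
  have hm : ∫ r in Ioi 0 ∩ S, hl2Den (fun r => φ t r - φL t r) (fun r => pT φ t r - pT φL t r) r ≤
      hl2Sq (fun r => φ t r - φL t r) (fun r => pT φ t r - pT φL t r) (Ioi 0) :=
    setIntegral_mono_set h3 ((ae_restrict_iff' measurableSet_Ioi).2 (Eventually.of_forall
      fun r hr => hl2Den_nonneg _ _ hr)) (Eventually.of_forall inter_subset_left)
  unfold hl2Sq at hm ⊢
  linarith

theorem hl2Sq_nonneg (f g : ℝ → ℝ) {S : Set ℝ} (hS : MeasurableSet S) :
    0 ≤ hl2Sq f g (Ioi 0 ∩ S) :=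
  setIntegral_nonneg (measurableSet_Ioi.inter hS) fun _ hr => hl2Den_nonneg _ _ hr.1

theorem measurableSet_le_abs_sub (A t : ℝ) : MeasurableSet {r : ℝ | A ≤ |r - t|} :=
  measurableSet_le measurable_const (by fun_prop)

theorem exists_eventually_hl2Sq_le (h : IsWaveMap φ) (hfe : FiniteEnergy φ) (hbc : DegreeZeroBC φ)
    (hlin : IsLinearWave φL) (hlinfe : LinFiniteEnergy φL)
    (hscat : Tendsto (fun t => hl2Sq (fun r => φ t r - φL t r) (fun r => pT φ t r - pT φL t r)
      (Ioi 0)) atTop (nhds 0)) {ε : ℝ} (hε : 0 < ε) :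
    ∃ A₀ > 0, ∀ A, A₀ ≤ A →
      ∀ᶠ t in atTop, hl2Sq (φ t) (pT φ t) (Ioi 0 ∩ {r | A ≤ |r - t|}) ≤ ε := by
  obtain ⟨A₀, hA₀, hd⟩ := (hlin.isLinSol hlinfe).exists_integral_linDen_le
    (by positivity : 0 < ε / 4)
  refine ⟨A₀, hA₀, fun A hA => ?_⟩
  filter_upwards [eventually_gt_atTop 0, hscat.eventually (gt_mem_nhds (by positivity : 0 < ε / 4))]
    with t ht hs
  have h1 := hl2Sq_le_of_sub h hfe hbc hlin hlinfe ht (measurableSet_le_abs_sub A t)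
  have h2 : hl2Sq (φL t) (pT φL t) (Ioi 0 ∩ {r | A ≤ |r - t|}) ≤ ε / 4 := hd A hA t ht.le
  linarith

theorem totE_sub_le_exterior (h : IsWaveMap φ) (hfe : FiniteEnergy φ) (hcons : EnergyConserved φ)
    (hbc : DegreeZeroBC φ) {t A : ℝ} (ht : 0 < t) :
    totE φ 0 - hl2Sq (φ t) (pT φ t) (Ioi 0 ∩ {r | A ≤ |r - t|}) ≤
      ∫ r in Ioi 0 ∩ Ici (t - A), eDen φ t r := by
  have hsplit := integral_inter_add_sdiff (s := Ioi (0 : ℝ)) (measurableSet_Ici (a := t - A))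
    (hfe t ht.le)
  have hE : ∫ r in Ioi 0, eDen φ t r = totE φ 0 := hcons t ht.le
  have hi := h.integrableOn_hl2Den hfe hbc ht
  have h1 : ∫ r in Ioi 0 \ Ici (t - A), eDen φ t r ≤
      ∫ r in Ioi 0 \ Ici (t - A), hl2Den (φ t) (pT φ t) r :=
    setIntegral_mono_on ((hfe t ht.le).mono_set sdiff_subset) (hi.mono_set sdiff_subset)
      (measurableSet_Ioi.diff measurableSet_Ici) fun r hr => eDen_le_hl2Den φ t hr.1
  have h2 : ∫ r in Ioi 0 \ Ici (t - A), hl2Den (φ t) (pT φ t) r ≤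
      hl2Sq (φ t) (pT φ t) (Ioi 0 ∩ {r | A ≤ |r - t|}) := by
    refine setIntegral_mono_set (hi.mono_set inter_subset_left)
      ((ae_restrict_iff' (measurableSet_Ioi.inter (measurableSet_le_abs_sub A t))).2
        (Eventually.of_forall fun r hr => hl2Den_nonneg _ _ hr.1))
      (Eventually.of_forall fun r hr => ⟨hr.1, ?_⟩)
    have : r < t - A := not_le.1 hr.2
    exact (by linarith : A ≤ -(r - t)).trans (neg_le_abs _)
  linarith

theorem exterior_le_totE (hfe : FiniteEnergy φ) (hcons : EnergyConserved φ) {t : ℝ} (ht : 0 ≤ t)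
    (c : ℝ) : ∫ r in Ioi 0 ∩ Ici c, eDen φ t r ≤ totE φ 0 := by
  rw [← hcons t ht]
  exact setIntegral_mono_set (hfe t ht) ((ae_restrict_iff' measurableSet_Ioi).2
    (Eventually.of_forall fun r hr => eDen_nonneg φ t hr)) (Eventually.of_forall inter_subset_left)

end Transfer

/-- properties of the nonlinear radiation `φ`: concentration of its `H×L²` norm
near the light cone, and the exterior energy `E_{t−A}^∞(φ⃗(t))` carries all the energy. -/
theorem stmt13_radiation_properties
    (φ φL : ℝ → ℝ → ℝ)
    (hwm : IsWaveMap φ) (hfe : FiniteEnergy φ) (hcons : EnergyConserved φ)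
    (hbc : DegreeZeroBC φ)
    (hlin : IsLinearWave φL) (hlinfe : LinFiniteEnergy φL)
    (hscat : Filter.Tendsto
      (fun t => hl2Sq (fun r => φ t r - φL t r) (fun r => pT φ t r - pT φL t r) (Set.Ioi 0))
      Filter.atTop (nhds 0)) :
    ((∀ ε > 0, ∃ A₀ > 0, ∀ A : ℝ, A₀ ≤ A →
        Filter.limsup
          (fun t : ℝ => hl2Sq (φ t) (pT φ t) (Set.Ioi 0 ∩ {r : ℝ | A ≤ |r - t|}))
          Filter.atTop ≤ ε) ∧
      ∃ L : ℝ → ℝ,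
        (∀ A : ℝ, 0 ≤ A →
          Filter.Tendsto
            (fun t => ∫ r in Set.Ioi 0 ∩ Set.Ici (t - A), eDen φ t r)
            Filter.atTop (nhds (L A))) ∧
        Filter.Tendsto L Filter.atTop (nhds (totE φ 0))) := by
  have key := fun {ε : ℝ} (hε : 0 < ε) =>
    exists_eventually_hl2Sq_le hwm hfe hbc hlin hlinfe hscat hε
  refine ⟨fun ε hε => ?_, ?_⟩
  · obtain ⟨A₀, hA₀, hA⟩ := key hε
    refine ⟨A₀, hA₀, fun A h => limsup_le_of_le ?_ (hA A h)⟩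
    exact (isBoundedUnder_of_eventually_ge (a := 0) (Eventually.of_forall fun t =>
      hl2Sq_nonneg _ _ (measurableSet_le_abs_sub A t))).isCoboundedUnder_le
  · have hex : ∀ A : ℝ, ∃ L, 0 ≤ A →
        Tendsto (fun t => ∫ r in Ioi 0 ∩ Ici (t - A), eDen φ t r) atTop (nhds L) := fun A => by
      by_cases hA : 0 ≤ A
      · obtain ⟨L, hL⟩ := exists_tendsto_exterior_energy hwm hfe hcons hA
        exact ⟨L, fun _ => hL⟩
      · exact ⟨0, fun h => absurd h hA⟩
    choose L hL using hex
    refine ⟨L, hL, tendsto_order.2 ⟨fun c hc => ?_, fun c hc => ?_⟩⟩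
    · obtain ⟨A₀, hA₀, hA⟩ := key (half_pos (sub_pos.2 hc))
      filter_upwards [eventually_ge_atTop A₀] with A h
      have : totE φ 0 - (totE φ 0 - c) / 2 ≤ L A := by
        refine ge_of_tendsto (hL A (hA₀.le.trans h)) ?_
        filter_upwards [hA A h, eventually_gt_atTop 0] with t h1 ht
        linarith [totE_sub_le_exterior hwm hfe hcons hbc (A := A) ht]
      linarith
    · filter_upwards [eventually_ge_atTop 0] with A h
      refine lt_of_le_of_lt (le_of_tendsto (hL A h) ?_) hc
      filter_upwards [eventually_ge_atTop 0] with t ht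
      exact exterior_le_totE hfe hcons ht _
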